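/- arXiv:2210.06760 — 2 statements merged into one kernel-verified Lean document; each statement's English description precedes it below -/
import Mathlib

section
/- Let d ≥ 1, s ∈ (0,1), and let c ∈ (-1, 2s). For x in the half-space ℝ^d_+ = {x : x_d > 0}, the principal-value integral P.V. ∫_{ℝ^d_+} (y_d^c - x_d^c)/|x-y|^{d+2s} dy equals γ(2s,c)·(π^{(d-1)/2}·Γ((1+2s)/2)/Γ((d+2s)/2))·x_d^{c-2s}, where γ(a,b) = ∫₀¹ (t^b − 1)(1 − t^{a−b−1})/(1−t)^{1+a} dt. -/
open Real Set MeasureTheory Filter Topology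

section Kernel

variable {V : Type*} [NormedAddCommGroup V] [InnerProductSpace ℝ V] [FiniteDimensional ℝ V]
  [MeasurableSpace V] [BorelSpace V]

theorem integral_rpow_neg_sq_add_norm_sq {h p : ℝ} (hh : 0 < h)
    (hp : (Module.finrank ℝ V : ℝ) / 2 < p) :
    ∫ z : V, (h ^ 2 + ‖z‖ ^ 2) ^ (-p) =
      π ^ ((Module.finrank ℝ V : ℝ) / 2) * Gamma (p - (Module.finrank ℝ V : ℝ) / 2) / Gamma p *
        h ^ ((Module.finrank ℝ V : ℝ) - 2 * p) := by
  set n : ℝ := (Module.finrank ℝ V : ℝ) with hn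
  have hn0 : 0 ≤ n := Nat.cast_nonneg _
  have hp0 : 0 < p := by linarith
  have hΓ : 0 < Gamma p := Gamma_pos_of_pos hp0
  let F : V → ℝ → ℝ := fun z u => u ^ (p - 1) * rexp (-((h ^ 2 + ‖z‖ ^ 2) * u))
  have hinner : ∀ u ∈ Ioi (0 : ℝ), ∫ z : V, F z u =
      π ^ (n / 2) * (u ^ (p - n / 2 - 1) * rexp (-(h ^ 2 * u))) := by
    intro u hu
    have hu : 0 < u := hu
    have e : ∀ z : V, F z u = u ^ (p - 1) * rexp (-(h ^ 2 * u)) * rexp (-u * ‖z‖ ^ 2) := by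
      intro z
      simp only [F]
      rw [mul_assoc, ← Real.exp_add]
      ring_nf
    simp_rw [e]
    rw [integral_const_mul, GaussianFourier.integral_rexp_neg_mul_sq_norm hu, ← hn,
      Real.div_rpow pi_pos.le hu.le, show p - n / 2 - 1 = (p - 1) - n / 2 by ring,
      Real.rpow_sub hu (p - 1)]
    ring
  have hpow : 0 < p - n / 2 := by linarith
  have hu_int : IntegrableOn (fun u : ℝ => u ^ (p - n / 2 - 1) * rexp (-(h ^ 2 * u))) (Ioi 0) := by
    apply Integrable.of_integral_ne_zero
    rw [Real.integral_rpow_mul_exp_neg_mul_Ioi hpow (by positivity)]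
    have := Gamma_pos_of_pos hpow
    positivity
  have hmeas : Measurable (Function.uncurry F) := by
    simp only [F, Function.uncurry_def]
    fun_prop
  have hF : Integrable (Function.uncurry F) ((volume : Measure V).prod (volume.restrict (Ioi 0))) := by
    rw [integrable_prod_iff' hmeas.aestronglyMeasurable]
    have hnorm : ∀ u ∈ Ioi (0 : ℝ), ∀ z : V, ‖F z u‖ = F z u := by
      intro u hu z
      have : 0 < u := hu
      exact Real.norm_of_nonneg (by simp only [F]; positivity)
    constructor
    · refine ae_restrict_of_forall_mem measurableSet_Ioi fun u hu => ?_
      have hu' : 0 < u := hu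
      apply Integrable.of_integral_ne_zero
      simp only [Function.uncurry_apply_pair]
      rw [hinner u hu]
      positivity
    · refine (Integrable.const_mul hu_int (π ^ (n / 2))).congr ?_
      refine ae_restrict_of_forall_mem measurableSet_Ioi fun u hu => ?_
      simp only [Function.uncurry_apply_pair]
      rw [← hinner u hu]
      exact integral_congr_ae (Eventually.of_forall fun z => (hnorm u hu z).symm)
  have hswap := integral_integral_swap hF
  rw [setIntegral_congr_fun measurableSet_Ioi hinner, integral_const_mul,
    Real.integral_rpow_mul_exp_neg_mul_Ioi hpow (by positivity)] at hswap
  have hleft : ∀ z : V, ∫ u in Ioi 0, F z u = Gamma p * (h ^ 2 + ‖z‖ ^ 2) ^ (-p) := by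
    intro z
    have : 0 < h ^ 2 + ‖z‖ ^ 2 := by positivity
    rw [Real.integral_rpow_mul_exp_neg_mul_Ioi hp0 this, one_div, Real.inv_rpow this.le,
      Real.rpow_neg this.le, mul_comm]
  simp_rw [hleft] at hswap
  rw [integral_const_mul] at hswap
  have hpw : (1 / h ^ 2) ^ (p - n / 2) = h ^ (n - 2 * p) := by
    rw [one_div, ← Real.rpow_natCast, ← Real.rpow_neg hh.le, ← Real.rpow_mul hh.le]
    congr 1
    push_cast
    ring
  rw [hpw] at hswap
  rw [div_mul_eq_mul_div, eq_div_iff hΓ.ne']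
  linarith

theorem integrable_rpow_neg_sq_add_norm_sq {h p : ℝ} (hh : 0 < h)
    (hp : (Module.finrank ℝ V : ℝ) / 2 < p) :
    Integrable fun z : V => (h ^ 2 + ‖z‖ ^ 2) ^ (-p) := by
  apply Integrable.of_integral_ne_zero
  rw [integral_rpow_neg_sq_add_norm_sq hh hp]
  have hn0 : (0 : ℝ) ≤ Module.finrank ℝ V := Nat.cast_nonneg _
  have := Gamma_pos_of_pos (show 0 < p by linarith)
  have := Gamma_pos_of_pos (sub_pos.2 hp)
  positivity

theorem setIntegral_prod_mul_rpow_neg {S : Set ℝ} (hS : MeasurableSet S) {g : ℝ → ℝ}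
    (hg : Measurable g) {a p : ℝ} (ha : a ∉ S) (w : V) (hp : (Module.finrank ℝ V : ℝ) / 2 < p)
    (hint : IntegrableOn (fun t => g t * |t - a| ^ ((Module.finrank ℝ V : ℝ) - 2 * p)) S) :
    ∫ q in S ×ˢ (univ : Set V), g q.1 * ((a - q.1) ^ 2 + ‖w - q.2‖ ^ 2) ^ (-p) =
      π ^ ((Module.finrank ℝ V : ℝ) / 2) * Gamma (p - (Module.finrank ℝ V : ℝ) / 2) / Gamma p *
        ∫ t in S, g t * |t - a| ^ ((Module.finrank ℝ V : ℝ) - 2 * p) := by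
  set n : ℝ := (Module.finrank ℝ V : ℝ) with hn
  set K := π ^ (n / 2) * Gamma (p - n / 2) / Gamma p with hK
  have habs : ∀ t ∈ S, 0 < |t - a| := fun t ht =>
    abs_pos.2 (sub_ne_zero.2 fun h => ha (h ▸ ht))
  have hkint : ∀ t ∈ S, Integrable fun z : V => ((a - t) ^ 2 + ‖w - z‖ ^ 2) ^ (-p) := by
    intro t ht
    have := (integrable_rpow_neg_sq_add_norm_sq (V := V) (habs t ht) hp).comp_sub_left w
    simpa only [sq_abs, sub_sq_comm t a] using this
  have hker : ∀ t ∈ S, ∫ z : V, ((a - t) ^ 2 + ‖w - z‖ ^ 2) ^ (-p) = K * |t - a| ^ (n - 2 * p) := by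
    intro t ht
    have h1 := integral_sub_left_eq_self (fun z : V => (|t - a| ^ 2 + ‖z‖ ^ 2) ^ (-p)) volume w
    rw [integral_rpow_neg_sq_add_norm_sq (habs t ht) hp] at h1
    simpa only [sq_abs, sub_sq_comm t a] using h1
  have hmeas : Measurable fun q : ℝ × V => g q.1 * ((a - q.1) ^ 2 + ‖w - q.2‖ ^ 2) ^ (-p) := by
    fun_prop
  have hI : IntegrableOn (fun q : ℝ × V => g q.1 * ((a - q.1) ^ 2 + ‖w - q.2‖ ^ 2) ^ (-p))
      (S ×ˢ univ) (volume.prod volume) := by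
    rw [IntegrableOn, ← Measure.prod_restrict, Measure.restrict_univ,
      integrable_prod_iff hmeas.aestronglyMeasurable]
    constructor
    · exact ae_restrict_of_forall_mem hS fun t ht => (hkint t ht).const_mul (g t)
    · refine (hint.norm.const_mul K).congr ?_
      refine ae_restrict_of_forall_mem hS fun t ht => ?_
      have h0 : ∀ z : V, ‖g t * ((a - t) ^ 2 + ‖w - z‖ ^ 2) ^ (-p)‖
          = ‖g t‖ * ((a - t) ^ 2 + ‖w - z‖ ^ 2) ^ (-p) := fun z => by
        rw [norm_mul, Real.norm_of_nonneg (by positivity : 0 ≤ ((a - t) ^ 2 + ‖w - z‖ ^ 2) ^ (-p))]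
      simp_rw [h0]
      rw [integral_const_mul, hker t ht, norm_mul,
        Real.norm_of_nonneg (by positivity : 0 ≤ |t - a| ^ (n - 2 * p))]
      ring
  rw [Measure.volume_eq_prod, setIntegral_prod _ hI, ← integral_const_mul]
  refine setIntegral_congr_fun hS fun t ht => ?_
  simp only [Measure.restrict_univ]
  rw [integral_const_mul, hker t ht]
  ring

end Kernel

theorem setIntegral_euclideanSpace_succ {n : ℕ} (S : Set ℝ) (G : ℝ × EuclideanSpace ℝ (Fin n) → ℝ) :
    ∫ y in {y : EuclideanSpace ℝ (Fin (n + 1)) | y (Fin.last n) ∈ S},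
        G (y (Fin.last n), WithLp.toLp 2 fun i => y i.castSucc) =
      ∫ q in S ×ˢ univ, G q := by
  let e := ((MeasurableEquiv.toLp 2 (Fin (n + 1) → ℝ)).symm.trans
    (MeasurableEquiv.piFinSuccAbove (fun _ => ℝ) (Fin.last n))).trans
    ((MeasurableEquiv.refl ℝ).prodCongr (MeasurableEquiv.toLp 2 (Fin n → ℝ)))
  have he : MeasurePreserving e :=
    ((MeasurePreserving.id volume).prod (PiLp.volume_preserving_toLp (Fin n))).comp
      ((volume_preserving_piFinSuccAbove (fun _ => ℝ) (Fin.last n)).comp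
        (PiLp.volume_preserving_ofLp (Fin (n + 1))))
  have hval : ∀ y, e y = (y (Fin.last n), WithLp.toLp 2 fun i => y i.castSucc) := by
    intro y
    refine Prod.ext rfl ?_
    ext i
    change y ((Fin.last n).succAbove i) = y i.castSucc
    rw [Fin.succAbove_last]
  rw [← he.setIntegral_preimage_emb e.measurableEmbedding]
  simp_rw [hval]
  congr 2
  ext y
  simp [hval]

section OneDim

theorem exists_abs_rpow_sub_one_le (q : ℝ) :
    ∃ M, 0 ≤ M ∧ ∀ t ∈ Icc (1 / 2 : ℝ) 1, |t ^ q - 1| ≤ M * (1 - t) := by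
  have hne : ∀ t ∈ Icc (1 / 2 : ℝ) 1, t ≠ 0 := fun t ht => by
    have := ht.1
    positivity
  obtain ⟨M, hM⟩ := isCompact_Icc.exists_bound_of_continuousOn
    (f := fun t : ℝ => q * t ^ (q - 1)) (s := Icc (1 / 2 : ℝ) 1)
    (continuousOn_const.mul (continuousOn_id.rpow_const fun t ht => Or.inl (hne t ht)))
  have h1 : (1 : ℝ) ∈ Icc (1 / 2 : ℝ) 1 := by norm_num
  refine ⟨M, (norm_nonneg _).trans (hM 1 h1), fun t ht => ?_⟩
  have := (convex_Icc (1 / 2 : ℝ) 1).norm_image_sub_le_of_norm_hasDerivWithin_le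
    (fun x hx => (Real.hasDerivAt_rpow_const (p := q) (Or.inl (hne x hx))).hasDerivWithinAt)
    hM h1 ht
  rwa [Real.one_rpow, Real.norm_eq_abs, Real.norm_eq_abs, abs_sub_comm t 1,
    abs_of_nonneg (by linarith [ht.2] : 0 ≤ 1 - t)] at this

theorem integrableOn_rpow_mul_one_sub_rpow {u r : ℝ} (hu : -1 < u) (hr0 : 0 ≤ r) (hr : r < 1)
    (β : ℝ) : IntegrableOn (fun t : ℝ => t ^ u * (1 - t) ^ β) (Ioo 0 r) := by
  have h1 : IntegrableOn (fun t : ℝ => t ^ u) (Ioo 0 r) :=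
    ((intervalIntegrable_iff_integrableOn_Ioc_of_le hr0).1
      (intervalIntegral.intervalIntegrable_rpow' hu)).mono_set Ioo_subset_Ioc_self
  refine h1.mul_continuousOn_of_subset (K := Icc 0 r) ?_ measurableSet_Ioo isCompact_Icc
    Ioo_subset_Icc_self
  exact (continuousOn_const.sub continuousOn_id).rpow_const fun t ht =>
    Or.inl (sub_pos.2 (ht.2.trans_lt hr)).ne'

theorem integrableOn_rpow_sub_rpow_mul_one_sub_rpow {u v r : ℝ} (hu : -1 < u) (hv : -1 < v)
    (hr0 : 0 ≤ r) (hr : r < 1) (β : ℝ) :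
    IntegrableOn (fun t : ℝ => (t ^ u - t ^ v) * (1 - t) ^ β) (Ioo 0 r) := by
  simp_rw [sub_mul]
  exact (integrableOn_rpow_mul_one_sub_rpow hu hr0 hr β).sub
    (integrableOn_rpow_mul_one_sub_rpow hv hr0 hr β)

variable {c σ : ℝ}

theorem integrableOn_rpow_sub_one_mul_one_sub_rpow (hc : -1 < c) (hcσ : c < σ) (hσ : 0 < σ)
    (hσ2 : σ < 2) :
    IntegrableOn (fun t : ℝ => (t ^ c - 1) * (1 - t ^ (σ - c - 1)) * (1 - t) ^ (-(1 + σ)))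
      (Ioo 0 1) := by
  have hsplit : Ioo (0 : ℝ) 1 ⊆ Ioo 0 (3 / 4) ∪ Ico (1 / 2) 1 := by
    intro t ht
    by_cases h : t < 3 / 4
    · exact Or.inl ⟨ht.1, h⟩
    · exact Or.inr ⟨by linarith, ht.2⟩
  refine IntegrableOn.mono_set (IntegrableOn.union ?_ ?_) hsplit
  · have h1 := integrableOn_rpow_sub_rpow_mul_one_sub_rpow (u := c) (v := 0) (r := 3 / 4) hc
      (by norm_num) (by norm_num) (by norm_num) (-(1 + σ))
    have h2 := integrableOn_rpow_sub_rpow_mul_one_sub_rpow (u := σ - c - 1) (v := σ - 1)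
      (r := 3 / 4) (by linarith) (by linarith) (by norm_num) (by norm_num) (-(1 + σ))
    refine (h1.add h2).congr_fun (fun t ht => ?_) measurableSet_Ioo
    have : t ^ (σ - 1) = t ^ c * t ^ (σ - c - 1) := by
      rw [← Real.rpow_add ht.1]
      ring_nf
    simp only [Pi.add_apply, Real.rpow_zero, this]
    ring
  · obtain ⟨M, hM0, hM⟩ := exists_abs_rpow_sub_one_le c
    obtain ⟨N, hN0, hN⟩ := exists_abs_rpow_sub_one_le (σ - c - 1)
    have hdom : IntegrableOn (fun t : ℝ => M * N * (1 - t) ^ (1 - σ)) (Ico (1 / 2) 1) := by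
      have h := (intervalIntegral.intervalIntegrable_rpow' (a := 1 / 2) (b := 0) (r := 1 - σ)
        (by linarith)).comp_sub_left 1
      norm_num at h
      have h := (intervalIntegrable_iff_integrableOn_Ico_of_le (by norm_num)).1 h
      exact h.const_mul (M * N)
    refine Integrable.mono' hdom (by fun_prop) ?_
    refine ae_restrict_of_forall_mem measurableSet_Ico fun t ht => ?_
    have ht' : t ∈ Icc (1 / 2 : ℝ) 1 := ⟨ht.1, ht.2.le⟩
    have h1t : 0 < 1 - t := by linarith [ht.2]
    have hpos : 0 ≤ (1 - t) ^ (-(1 + σ)) := by positivity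
    rw [norm_mul, norm_mul, Real.norm_of_nonneg hpos, Real.norm_eq_abs, Real.norm_eq_abs,
      abs_sub_comm 1]
    calc |t ^ c - 1| * |t ^ (σ - c - 1) - 1| * (1 - t) ^ (-(1 + σ))
        ≤ (M * (1 - t)) * (N * (1 - t)) * (1 - t) ^ (-(1 + σ)) := by
          have := hM t ht'
          have := hN t ht'
          gcongr
      _ = M * N * (1 - t) ^ (1 - σ) := by
          rw [show 1 - σ = 2 + -(1 + σ) by ring, Real.rpow_add h1t, Real.rpow_two]
          ring

theorem tendsto_setIntegral_Ico_one_sub (hσ : 0 < σ) (hσ2 : σ < 2) (c q : ℝ) :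
    Tendsto (fun δ : ℝ => ∫ t in Ico (1 - δ) (1 / (1 + δ)),
      (t ^ q - t ^ c) * (1 - t) ^ (-(1 + σ))) (𝓝[>] 0) (𝓝 0) := by
  obtain ⟨M, hM0, hM⟩ := exists_abs_rpow_sub_one_le c
  obtain ⟨N, hN0, hN⟩ := exists_abs_rpow_sub_one_le q
  have hlim : Tendsto (fun δ : ℝ => (N + M) * (1 / 2) ^ (-σ) * δ ^ (2 - σ)) (𝓝[>] 0) (𝓝 0) := by
    have h := (Real.continuousAt_rpow_const 0 (2 - σ) (Or.inr (by linarith))).tendsto.const_mul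
      ((N + M) * (1 / 2) ^ (-σ))
    rw [Real.zero_rpow (by linarith), mul_zero] at h
    exact h.mono_left nhdsWithin_le_nhds
  refine squeeze_zero_norm' ?_ hlim
  filter_upwards [Ioo_mem_nhdsGT (show (0 : ℝ) < 1 / 2 by norm_num)] with δ hδ
  obtain ⟨h0, h1⟩ := hδ
  have hbound : ∀ t ∈ Ico (1 - δ) (1 / (1 + δ)), ‖(t ^ q - t ^ c) * (1 - t) ^ (-(1 + σ))‖ ≤
      (N + M) * (1 / 2 * δ) ^ (-σ) := by
    intro t ht
    have hδt : 1 / 2 * δ ≤ 1 - t := by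
      have : 1 / (1 + δ) ≤ 1 - 1 / 2 * δ := by
        rw [div_le_iff₀ (by linarith)]
        nlinarith
      linarith [ht.2]
    have h1t : 0 < 1 - t := by linarith
    have ht' : t ∈ Icc (1 / 2 : ℝ) 1 := ⟨by linarith [ht.1], by linarith⟩
    rw [norm_mul, Real.norm_of_nonneg (by positivity : 0 ≤ (1 - t) ^ (-(1 + σ))), Real.norm_eq_abs]
    calc |t ^ q - t ^ c| * (1 - t) ^ (-(1 + σ))
        ≤ ((N + M) * (1 - t)) * (1 - t) ^ (-(1 + σ)) := by
          gcongr
          have := abs_sub_le (t ^ q) 1 (t ^ c)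
          rw [abs_sub_comm 1] at this
          linarith [hM t ht', hN t ht']
      _ = (N + M) * (1 - t) ^ (-σ) := by
          rw [show -σ = 1 + -(1 + σ) by ring, Real.rpow_add h1t, Real.rpow_one]
          ring
      _ ≤ (N + M) * (1 / 2 * δ) ^ (-σ) := by
          gcongr (N + M) * ?_
          exact Real.rpow_le_rpow_of_nonpos (by positivity) hδt (by linarith)
  have hlen : volume.real (Ico (1 - δ) (1 / (1 + δ))) ≤ δ ^ 2 := by
    rw [Real.volume_real_Ico]
    refine max_le ?_ (by positivity)
    rw [sub_le_iff_le_add, div_le_iff₀ (by linarith)]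
    nlinarith [pow_pos h0 3]
  calc _ ≤ (N + M) * (1 / 2 * δ) ^ (-σ) * volume.real (Ico (1 - δ) (1 / (1 + δ))) :=
        norm_setIntegral_le_of_norm_le_const measure_Ico_lt_top hbound
    _ ≤ (N + M) * (1 / 2 * δ) ^ (-σ) * δ ^ 2 := by gcongr
    _ = (N + M) * (1 / 2) ^ (-σ) * δ ^ (2 - σ) := by
        rw [Real.mul_rpow (by norm_num) h0.le, show 2 - σ = 2 + -σ by ring, Real.rpow_add h0,
          Real.rpow_two]
        ring

theorem tendsto_setIntegral_add (hc : -1 < c) (hcσ : c < σ) (hσ : 0 < σ) (hσ2 : σ < 2) :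
    Tendsto (fun δ : ℝ => (∫ t in Ioo 0 (1 - δ), (t ^ c - 1) * (1 - t) ^ (-(1 + σ))) +
        ∫ t in Ioo 0 (1 / (1 + δ)), (t ^ (σ - c - 1) - t ^ (σ - 1)) * (1 - t) ^ (-(1 + σ)))
      (𝓝[>] 0)
      (𝓝 (∫ t in Ioo (0 : ℝ) 1, (t ^ c - 1) * (1 - t ^ (σ - c - 1)) * (1 - t) ^ (-(1 + σ)))) := by
  have hint := integrableOn_rpow_sub_one_mul_one_sub_rpow hc hcσ hσ hσ2
  have hprim : Tendsto (fun δ : ℝ => ∫ t in Ioo 0 (1 - δ),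
      (t ^ c - 1) * (1 - t ^ (σ - c - 1)) * (1 - t) ^ (-(1 + σ))) (𝓝[>] 0)
      (𝓝 (∫ t in Ioo (0 : ℝ) 1,
        (t ^ c - 1) * (1 - t ^ (σ - c - 1)) * (1 - t) ^ (-(1 + σ)))) := by
    have hcont := intervalIntegral.continuousOn_primitive (μ := volume)
      ((integrableOn_Icc_iff_integrableOn_Ioo).2 hint) 1 (right_mem_Icc.2 zero_le_one)
    simp only [ContinuousWithinAt, integral_Ioc_eq_integral_Ioo] at hcont
    refine hcont.comp (tendsto_nhdsWithin_iff.2 ⟨?_, ?_⟩)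
    · have : Tendsto (fun δ : ℝ => 1 - δ) (𝓝 0) (𝓝 (1 - 0)) := tendsto_const_nhds.sub tendsto_id
      rw [sub_zero] at this
      exact this.mono_left nhdsWithin_le_nhds
    · filter_upwards [Ioo_mem_nhdsGT (zero_lt_one (α := ℝ))] with δ hδ
      exact ⟨by linarith [hδ.2], by linarith [hδ.1]⟩
  have hsum := hprim.add (tendsto_setIntegral_Ico_one_sub hσ hσ2 (σ - 1) (σ - c - 1))
  rw [add_zero] at hsum
  refine hsum.congr' ?_
  filter_upwards [Ioo_mem_nhdsGT (zero_lt_one (α := ℝ))] with δ hδ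
  obtain ⟨h0, h1⟩ := hδ
  have hr1 : 1 / (1 + δ) < 1 := by rw [div_lt_one (by linarith)]; linarith
  have hle : 1 - δ ≤ 1 / (1 + δ) := by
    rw [le_div_iff₀ (by linarith)]
    nlinarith
  have hA := integrableOn_rpow_sub_rpow_mul_one_sub_rpow (u := c) (v := 0) (r := 1 - δ) hc
    (by norm_num) (by linarith) (by linarith) (-(1 + σ))
  have hB := integrableOn_rpow_sub_rpow_mul_one_sub_rpow (u := σ - c - 1) (v := σ - 1)
    (r := 1 / (1 + δ)) (by linarith) (by linarith) (by positivity) hr1 (-(1 + σ))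
  simp only [Real.rpow_zero] at hA
  have hunion : Ioo 0 (1 / (1 + δ)) = Ioo 0 (1 - δ) ∪ Ico (1 - δ) (1 / (1 + δ)) :=
    (Ioo_union_Ico_eq_Ioo (by linarith) hle).symm
  have hdisj : Disjoint (Ioo 0 (1 - δ)) (Ico (1 - δ) (1 / (1 + δ))) :=
    Set.disjoint_left.2 fun t ht ht' => absurd ht.2 (not_lt.2 ht'.1)
  rw [hunion] at hB ⊢
  rw [setIntegral_union hdisj measurableSet_Ico hB.left_of_union hB.right_of_union, ← add_assoc,
    ← integral_add hA hB.left_of_union]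
  congr 1
  refine setIntegral_congr_fun measurableSet_Ioo fun t ht => ?_
  have : t ^ (σ - 1) = t ^ c * t ^ (σ - c - 1) := by
    rw [← Real.rpow_add ht.1]
    ring_nf
  simp only [this]
  ring

theorem image_mul_Ioo_zero {a : ℝ} (ha : 0 < a) (r : ℝ) :
    (fun u => a * u) '' Ioo 0 r = Ioo 0 (a * r) := by
  rw [Set.image_mul_left_Ioo ha, mul_zero]

theorem image_div_Ioo_zero {a r : ℝ} (ha : 0 < a) (hr : 0 < r) :
    (fun u => a / u) '' Ioo 0 r = Ioi (a / r) := by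
  ext t
  constructor
  · rintro ⟨u, hu, rfl⟩
    exact div_lt_div_of_pos_left ha hu.1 hu.2
  · intro ht
    have ht0 : 0 < t := (div_pos ha hr).trans ht
    refine ⟨a / t, ⟨div_pos ha ht0, ?_⟩, by field_simp⟩
    rw [div_lt_comm₀ ht0 hr]
    exact ht

theorem abs_sub_gt_eq_union {a ε : ℝ} (hε : 0 < ε) (hεa : ε < a) :
    {t : ℝ | 0 < t ∧ ε < |t - a|} = Ioo 0 (a * (1 - ε / a)) ∪ Ioi (a / (1 / (1 + ε / a))) := by
  have ha : 0 < a := hε.trans hεa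
  rw [show a * (1 - ε / a) = a - ε by field_simp,
    show a / (1 / (1 + ε / a)) = a + ε by field_simp]
  ext t
  simp only [mem_ofPred_eq, mem_union, mem_Ioo, mem_Ioi, lt_abs]
  constructor
  · rintro ⟨h0, h | h⟩
    · exact Or.inr (by linarith)
    · exact Or.inl ⟨h0, by linarith⟩
  · rintro (⟨h0, h⟩ | h)
    · exact ⟨h0, Or.inr (by linarith)⟩
    · exact ⟨by linarith, Or.inl (by linarith)⟩

theorem integral_near_part {a r : ℝ} (ha : 0 < a) (hc : -1 < c) (hr0 : 0 < r) (hr : r < 1) :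
    IntegrableOn (fun t => (t ^ c - a ^ c) * |t - a| ^ (-(1 + σ))) (Ioo 0 (a * r)) ∧
    ∫ t in Ioo 0 (a * r), (t ^ c - a ^ c) * |t - a| ^ (-(1 + σ)) =
      a ^ (c - σ) * ∫ t in Ioo 0 r, (t ^ c - 1) * (1 - t) ^ (-(1 + σ)) := by
  have hder : ∀ u ∈ Ioo 0 r, HasDerivWithinAt (fun u => a * u) a (Ioo 0 r) u := fun u _ => by
    simpa using ((hasDerivAt_id u).const_mul a).hasDerivWithinAt
  have hinj : InjOn (fun u => a * u) (Ioo 0 r) := (mul_right_injective₀ ha.ne').injOn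
  have hpt : ∀ u ∈ Ioo 0 r, a ^ (c - σ) * ((u ^ c - 1) * (1 - u) ^ (-(1 + σ))) =
      |a| • (((a * u) ^ c - a ^ c) * |a * u - a| ^ (-(1 + σ))) := by
    intro u hu
    have h1 : 0 < 1 - u := by linarith [hu.2]
    rw [abs_of_pos ha, show |a * u - a| = a * (1 - u) by
      rw [abs_sub_comm, abs_of_pos (by nlinarith)]; ring, Real.mul_rpow ha.le hu.1.le,
      Real.mul_rpow ha.le h1.le, show c - σ = 1 + c + -(1 + σ) by ring, Real.rpow_add ha,
      Real.rpow_add ha, Real.rpow_one, smul_eq_mul]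
    ring
  have hA := integrableOn_rpow_sub_rpow_mul_one_sub_rpow (u := c) (v := 0) hc
    (by norm_num) hr0.le hr (-(1 + σ))
  simp only [Real.rpow_zero] at hA
  rw [← image_mul_Ioo_zero ha, integrableOn_image_iff_integrableOn_abs_deriv_smul measurableSet_Ioo
    hder hinj, integral_image_eq_integral_abs_deriv_smul measurableSet_Ioo hder hinj]
  refine ⟨IntegrableOn.congr_fun (hA.const_mul _) hpt measurableSet_Ioo, ?_⟩
  rw [← setIntegral_congr_fun measurableSet_Ioo hpt, integral_const_mul]

theorem integral_far_part {a r : ℝ} (ha : 0 < a) (hσ : 0 < σ) (hcσ : c < σ) (hr0 : 0 < r)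
    (hr : r < 1) :
    IntegrableOn (fun t => (t ^ c - a ^ c) * |t - a| ^ (-(1 + σ))) (Ioi (a / r)) ∧
    ∫ t in Ioi (a / r), (t ^ c - a ^ c) * |t - a| ^ (-(1 + σ)) =
      a ^ (c - σ) * ∫ t in Ioo 0 r,
        (t ^ (σ - c - 1) - t ^ (σ - 1)) * (1 - t) ^ (-(1 + σ)) := by
  have hder : ∀ u ∈ Ioo 0 r, HasDerivWithinAt (fun u => a / u) (-(a / u ^ 2)) (Ioo 0 r) u :=
    fun u hu => by
      have := ((hasDerivAt_inv hu.1.ne').const_mul a).hasDerivWithinAt (s := Ioo 0 r)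
      simpa [div_eq_mul_inv] using this
  have hinj : InjOn (fun u => a / u) (Ioo 0 r) := fun u hu v hv h => by
    have := hu.1.ne'
    have := hv.1.ne'
    simp only at h
    field_simp at h
    exact h.symm
  have hpt : ∀ u ∈ Ioo 0 r,
      a ^ (c - σ) * ((u ^ (σ - c - 1) - u ^ (σ - 1)) * (1 - u) ^ (-(1 + σ))) =
      |-(a / u ^ 2)| • (((a / u) ^ c - a ^ c) * |a / u - a| ^ (-(1 + σ))) := by
    intro u hu
    have hu0 : 0 < u := hu.1
    have h1 : 0 < 1 - u := by linarith [hu.2]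
    rw [abs_neg, abs_of_pos (by positivity), show a / u - a = a * (1 - u) / u by field_simp,
      abs_of_pos (by positivity), Real.div_rpow ha.le hu0.le,
      Real.div_rpow (by positivity) hu0.le,
      Real.mul_rpow ha.le h1.le, show c - σ = 1 + c + -(1 + σ) by ring, Real.rpow_add ha,
      Real.rpow_add ha, Real.rpow_one, smul_eq_mul,
      show σ - c - 1 = -(-(1 + σ)) - c - 2 by ring, show σ - 1 = -(-(1 + σ)) - 2 by ring,
      Real.rpow_sub hu0, Real.rpow_sub hu0, Real.rpow_sub hu0, Real.rpow_neg hu0.le (-(1 + σ)),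
      Real.rpow_two]
    have := (Real.rpow_pos_of_pos hu0 c).ne'
    have := (Real.rpow_pos_of_pos hu0 (-(1 + σ))).ne'
    field_simp
  have hB := integrableOn_rpow_sub_rpow_mul_one_sub_rpow (u := σ - c - 1) (v := σ - 1)
    (by linarith) (by linarith) hr0.le hr (-(1 + σ))
  rw [← image_div_Ioo_zero ha hr0, integrableOn_image_iff_integrableOn_abs_deriv_smul
    measurableSet_Ioo hder hinj, integral_image_eq_integral_abs_deriv_smul measurableSet_Ioo
    hder hinj]
  refine ⟨IntegrableOn.congr_fun (hB.const_mul _) hpt measurableSet_Ioo, ?_⟩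
  rw [← setIntegral_congr_fun measurableSet_Ioo hpt, integral_const_mul]

theorem integral_abs_sub_gt {a ε : ℝ} (hε : 0 < ε) (hεa : ε < a) (hc : -1 < c) (hcσ : c < σ)
    (hσ : 0 < σ) :
    IntegrableOn (fun t => (t ^ c - a ^ c) * |t - a| ^ (-(1 + σ))) {t | 0 < t ∧ ε < |t - a|} ∧
    ∫ t in {t | 0 < t ∧ ε < |t - a|}, (t ^ c - a ^ c) * |t - a| ^ (-(1 + σ)) =
      a ^ (c - σ) * ((∫ t in Ioo 0 (1 - ε / a), (t ^ c - 1) * (1 - t) ^ (-(1 + σ))) +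
        ∫ t in Ioo 0 (1 / (1 + ε / a)),
          (t ^ (σ - c - 1) - t ^ (σ - 1)) * (1 - t) ^ (-(1 + σ))) := by
  have ha : 0 < a := hε.trans hεa
  have hδ0 : 0 < ε / a := by positivity
  have hδ1 : ε / a < 1 := (div_lt_one ha).2 hεa
  obtain ⟨hi1, he1⟩ := integral_near_part (σ := σ) ha hc (r := 1 - ε / a) (by linarith)
    (by linarith)
  obtain ⟨hi2, he2⟩ := integral_far_part ha hσ hcσ (r := 1 / (1 + ε / a)) (by positivity)
    (by rw [div_lt_one (by linarith)]; linarith)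
  rw [abs_sub_gt_eq_union hε hεa]
  refine ⟨hi1.union hi2, ?_⟩
  rw [setIntegral_union ?_ measurableSet_Ioi hi1 hi2, he1, he2, mul_add]
  refine Set.disjoint_left.2 fun t ht ht' => ?_
  have h1 : t < a - ε := by simpa [mul_sub, mul_div_cancel₀ _ ha.ne'] using ht.2
  have h2 : a / (1 / (1 + ε / a)) = a + ε := by field_simp
  have h3 : a + ε < t := h2 ▸ ht'
  linarith

end OneDim

theorem tendsto_setIntegral_halfSpace (n : ℕ) {s c : ℝ} (hs : 0 < s) (hs1 : s < 1) (hc : -1 < c)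
    (hcs : c < 2 * s) (x : EuclideanSpace ℝ (Fin (n + 1))) (hx : 0 < x (Fin.last n)) :
    Tendsto
      (fun ε : ℝ =>
        ∫ y in {y : EuclideanSpace ℝ (Fin (n + 1)) |
            0 < y (Fin.last n) ∧ ε < |y (Fin.last n) - x (Fin.last n)|},
          ((y (Fin.last n)) ^ c - (x (Fin.last n)) ^ c) /
            ‖x - y‖ ^ (((n + 1 : ℕ) : ℝ) + 2 * s))
      (𝓝[>] 0)
      (𝓝 ((∫ t in Ioo (0 : ℝ) 1,
              (t ^ c - 1) * (1 - t ^ (2 * s - c - 1)) / (1 - t) ^ (1 + 2 * s)) *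
            (π ^ ((((n + 1 : ℕ) : ℝ) - 1) / 2) * Real.Gamma ((1 + 2 * s) / 2) /
              Real.Gamma ((((n + 1 : ℕ) : ℝ) + 2 * s) / 2)) *
            (x (Fin.last n)) ^ (c - 2 * s))) := by
  set a := x (Fin.last n) with ha
  set w : EuclideanSpace ℝ (Fin n) := WithLp.toLp 2 fun i => x i.castSucc with hw
  set p : ℝ := ((n + 1 : ℕ) + 2 * s) / 2 with hp
  set K : ℝ := π ^ ((((n + 1 : ℕ) : ℝ) - 1) / 2) * Real.Gamma ((1 + 2 * s) / 2) / Real.Gamma p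
    with hK
  have hδ : Tendsto (fun ε : ℝ => ε / a) (𝓝[>] 0) (𝓝[>] 0) := by
    refine tendsto_nhdsWithin_iff.2 ⟨?_, ?_⟩
    · have : Tendsto (fun ε : ℝ => ε / a) (𝓝 0) (𝓝 (0 / a)) := tendsto_id.div_const a
      rw [zero_div] at this
      exact this.mono_left nhdsWithin_le_nhds
    · filter_upwards [self_mem_nhdsWithin] with ε hε
      exact div_pos hε hx
  have hlim := (((tendsto_setIntegral_add (σ := 2 * s) hc hcs (by linarith)
    (by linarith)).comp hδ).const_mul (K * a ^ (c - 2 * s)))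
  have hγ : ∫ t in Ioo (0 : ℝ) 1,
        (t ^ c - 1) * (1 - t ^ (2 * s - c - 1)) / (1 - t) ^ (1 + 2 * s) =
      ∫ t in Ioo (0 : ℝ) 1,
        (t ^ c - 1) * (1 - t ^ (2 * s - c - 1)) * (1 - t) ^ (-(1 + 2 * s)) := by
    refine setIntegral_congr_fun measurableSet_Ioo fun t ht => ?_
    rw [Real.rpow_neg (by linarith [ht.2]), div_eq_mul_inv]
  rw [hγ, mul_assoc, mul_comm (∫ t in Ioo (0 : ℝ) 1, _)]
  refine hlim.congr' ?_
  filter_upwards [Ioo_mem_nhdsGT hx] with ε hε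
  have hdim : (Module.finrank ℝ (EuclideanSpace ℝ (Fin n)) : ℝ) = n := by simp
  obtain ⟨hI, hE⟩ := integral_abs_sub_gt (σ := 2 * s) hε.1 hε.2 hc hcs (by linarith)
  have hexp : (n : ℝ) - 2 * p = -(1 + 2 * s) := by
    rw [hp]
    push_cast
    ring
  have hS : MeasurableSet {t : ℝ | 0 < t ∧ ε < |t - a|} := by
    rw [abs_sub_gt_eq_union hε.1 hε.2]
    exact measurableSet_Ioo.union measurableSet_Ioi
  have hfub := setIntegral_prod_mul_rpow_neg (V := EuclideanSpace ℝ (Fin n)) hS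
    (g := fun t => t ^ c - a ^ c) (by fun_prop) (a := a) (p := p)
    (fun h => by
      have := h.2
      rw [sub_self, abs_zero] at this
      exact lt_asymm hε.1 this) w
    (by rw [hdim, hp]; push_cast; linarith) (by rw [hdim, hexp]; exact hI)
  rw [hdim, hexp, hE, ← setIntegral_euclideanSpace_succ] at hfub
  have hKeq : π ^ ((n : ℝ) / 2) * Gamma (p - (n : ℝ) / 2) / Gamma p = K := by
    rw [hK, show p - (n : ℝ) / 2 = (1 + 2 * s) / 2 by rw [hp]; push_cast; ring]
    push_cast
    rw [add_sub_cancel_right]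
  rw [hKeq, ← mul_assoc] at hfub
  refine hfub.symm.trans ?_
  refine integral_congr_ae (Eventually.of_forall fun y => ?_)
  have hnorm : (a - y (Fin.last n)) ^ 2 + ‖w - WithLp.toLp 2 fun i => y i.castSucc‖ ^ 2 =
      ‖x - y‖ ^ 2 := by
    rw [EuclideanSpace.norm_sq_eq, EuclideanSpace.norm_sq_eq, Fin.sum_univ_castSucc, add_comm]
    simp [hw, ha]
  simp only [hnorm]
  rw [← Real.rpow_natCast, ← Real.rpow_mul (norm_nonneg _), div_eq_mul_inv,
    ← Real.rpow_neg (norm_nonneg _)]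
  congr 2
  rw [hp]
  push_cast
  ring

/-- For `c ∈ (-1,2s)` and `x` in the half-space `{x : x_d > 0}`, the principal-value
integral `P.V. ∫_{ℝ^d_+} (y_d^c - x_d^c)/|x-y|^{d+2s} dy` (limit over
`{y : y_d > 0, |y_d - x_d| > ε}` as `ε → 0⁺`) equals
`γ(2s,c) · (π^{(d-1)/2} Γ((1+2s)/2)/Γ((d+2s)/2)) · x_d^{c-2s}`, where
`γ(a,b) = ∫₀¹ (t^b-1)(1-t^{a-b-1})/(1-t)^{1+a} dt`. -/
theorem stmt_12 (d : ℕ) (s c : ℝ) (hd : 1 ≤ d) (hs : 0 < s) (hs1 : s < 1)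
    (hc : c ∈ Ioo (-1 : ℝ) (2 * s)) (x : EuclideanSpace ℝ (Fin d))
    (hx : 0 < x ⟨d - 1, by omega⟩) :
    Tendsto
      (fun ε : ℝ =>
        ∫ y in {y : EuclideanSpace ℝ (Fin d) |
            0 < y ⟨d - 1, by omega⟩ ∧ ε < |y ⟨d - 1, by omega⟩ - x ⟨d - 1, by omega⟩|},
          ((y ⟨d - 1, by omega⟩) ^ c - (x ⟨d - 1, by omega⟩) ^ c) /
            ‖x - y‖ ^ ((d : ℝ) + 2 * s))
      (𝓝[>] 0)
      (𝓝 ((∫ t in Ioo (0 : ℝ) 1,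
              (t ^ c - 1) * (1 - t ^ (2 * s - c - 1)) / (1 - t) ^ (1 + 2 * s)) *
            (π ^ (((d : ℝ) - 1) / 2) * Real.Gamma ((1 + 2 * s) / 2) /
              Real.Gamma (((d : ℝ) + 2 * s) / 2)) *
            (x ⟨d - 1, by omega⟩) ^ (c - 2 * s))) := by
  obtain ⟨n, rfl⟩ := Nat.exists_eq_add_of_le' hd
  exact tendsto_setIntegral_halfSpace n hs hs1 hc.1 hc.2 x hx
end

section
/- Let s ∈ (0,1), b ∈ (0, d-2s), d ≥ 1 with 2s < d, and let A_{d,-2s} = 4^s·Γ((d+2s)/2)/(π^{d/2}·|Γ(-s)|) and Δ^s u(x) = A_{d,-2s}·P.V.∫_{ℝ^d}(u(y)-u(x))/|x-y|^{d+2s} dy. Then for x ≠ 0, A_{d,-2s}^{-1}·Δ^s(|·|^{-b})(x) = P.V. ∫_{ℝ^d} (|y|^{-b} - |x|^{-b})/|x-y|^{d+2s} dy = -(π^{d/2}·Γ((b+2s)/2)·Γ((d-b)/2)·|Γ(-s)|)/(Γ((d+2s)/2)·Γ((d-b-2s)/2)·Γ(b/2)) · |x|^{-b-2s}. -/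
open Real Set MeasureTheory Filter Topology

lemma beta_integral_Ioo {a b : ℝ} (ha : 0 < a) (hb : 0 < b) :
    IntegrableOn (fun w : ℝ => w ^ (a - 1) * (1 - w) ^ (b - 1)) (Ioo 0 1) ∧
      ∫ w in Ioo (0 : ℝ) 1, w ^ (a - 1) * (1 - w) ^ (b - 1) =
        Real.Gamma a * Real.Gamma b / Real.Gamma (a + b) := by
  have hconv := Complex.betaIntegral_convergent (u := (a : ℂ)) (v := (b : ℂ)) (by simpa) (by simpa)
  rw [intervalIntegrable_iff_integrableOn_Ioo_of_le zero_le_one] at hconv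
  have hcongr : ∀ w ∈ Ioo (0 : ℝ) 1,
      ((w : ℂ) ^ ((a : ℂ) - 1) * (1 - (w : ℂ)) ^ ((b : ℂ) - 1)).re =
        w ^ (a - 1) * (1 - w) ^ (b - 1) := by
    intro w hw
    have h1 : (w : ℂ) ^ ((a : ℂ) - 1) = ((w ^ (a - 1) : ℝ) : ℂ) := by
      rw [Complex.ofReal_cpow hw.1.le]; push_cast; rfl
    have h2 : (1 - (w : ℂ)) ^ ((b : ℂ) - 1) = (((1 - w) ^ (b - 1) : ℝ) : ℂ) := by
      rw [Complex.ofReal_cpow (by linarith [hw.2])]; push_cast; rfl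
    rw [h1, h2, ← Complex.ofReal_mul, Complex.ofReal_re]
  refine ⟨(show IntegrableOn _ _ volume from hconv.re).congr_fun hcongr measurableSet_Ioo, ?_⟩
  have h := ProbabilityTheory.beta_eq_betaIntegralReal a b ha hb
  rw [ProbabilityTheory.beta] at h
  rw [h, Complex.betaIntegral, intervalIntegral.integral_of_le zero_le_one,
    integral_Ioc_eq_integral_Ioo, ← setIntegral_congr_fun measurableSet_Ioo hcongr]
  exact integral_re hconv

lemma abs_one_sub_rpow_sub_one_le {p w : ℝ} (hp : 0 < p) (hw : w ∈ Icc (0 : ℝ) 1) :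
    |(1 - w) ^ p - 1| ≤ max p 1 * w := by
  have h0 : 0 ≤ 1 - w := by linarith [hw.2]
  have hle : (1 - w) ^ p ≤ 1 := rpow_le_one h0 (by linarith [hw.1]) hp.le
  rw [abs_of_nonpos (by linarith)]
  rcases le_total 1 p with h | h
  · have := one_add_mul_self_le_rpow_one_add (s := -w) (by linarith [hw.2]) h
    rw [max_eq_left h]
    rw [← sub_eq_add_neg] at this
    linarith
  · rw [max_eq_right h]
    have := rpow_le_rpow_of_exponent_ge' h0 (by linarith [hw.1]) hp.le h
    rw [rpow_one] at this
    linarith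

/-- The truncated power `(1 - w)₊ ^ (p - 1)` minus its value at `w = 0`. -/
noncomputable def truncPowSub (p w : ℝ) : ℝ := (if w < 1 then (1 - w) ^ (p - 1) else 0) - 1

@[fun_prop]
lemma measurable_truncPowSub (p : ℝ) : Measurable (truncPowSub p) :=
  (Measurable.ite measurableSet_Iio (by fun_prop) (by fun_prop)).sub measurable_const

/-- The Beta integral `B(-s, p)`, regularised by subtracting `1` from `(1 - w)₊ ^ (p - 1)`. -/
lemma integral_rpow_mul_truncPowSub {s p : ℝ} (hs : 0 < s) (hs1 : s < 1) (hp : s < p) :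
    IntegrableOn (fun w : ℝ => w ^ (-s - 1) * truncPowSub p w) (Ioi 0) ∧
      ∫ w in Ioi (0 : ℝ), w ^ (-s - 1) * truncPowSub p w =
        Real.Gamma (-s) * Real.Gamma p / Real.Gamma (p - s) := by
  have hp0 : 0 < p := hs.trans hp
  obtain ⟨hBi, hB⟩ := beta_integral_Ioo (a := 1 - s) (b := p) (by linarith) hp0
  set B : ℝ → ℝ := fun w => w ^ (1 - s - 1) * (1 - w) ^ (p - 1) with hBdef
  set E : ℝ → ℝ := fun w => w ^ (-s - 1) * ((1 - w) ^ p - 1) with hEdef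
  set F : ℝ → ℝ := fun w => -(1 / s) * (w ^ (-s) * ((1 - w) ^ p - 1)) with hFdef
  have hwi : IntegrableOn (fun w : ℝ => max p 1 * w ^ (-s)) (Ioo 0 1) := by
    refine Integrable.const_mul ?_ _
    have := (intervalIntegral.intervalIntegrable_rpow' (a := 0) (b := 1) (r := -s) (by linarith))
    rwa [intervalIntegrable_iff_integrableOn_Ioo_of_le zero_le_one] at this
  have hEi : IntegrableOn E (Ioo 0 1) := by
    refine Integrable.mono' hwi
      (by rw [hEdef]; exact Measurable.aestronglyMeasurable (by fun_prop)) ?_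
    filter_upwards [ae_restrict_mem measurableSet_Ioo] with w hw
    rw [hEdef, norm_mul, Real.norm_of_nonneg (rpow_nonneg hw.1.le _), Real.norm_eq_abs]
    have := abs_one_sub_rpow_sub_one_le hp0 (Ioo_subset_Icc_self hw)
    calc w ^ (-s - 1) * |(1 - w) ^ p - 1| ≤ w ^ (-s - 1) * (max p 1 * w) := by
          gcongr; exact rpow_nonneg hw.1.le _
      _ = max p 1 * w ^ (-s) := by
          rw [rpow_sub_one hw.1.ne']; field_simp [hw.1.ne']
  have hF'i : IntegrableOn (fun w => E w + (p / s) * B w) (Ioo 0 1) := hEi.add (hBi.const_mul _)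
  have hderiv : ∀ w ∈ Ioo (0 : ℝ) 1, HasDerivAt F (E w + (p / s) * B w) w := by
    intro w hw
    have h1 : HasDerivAt (fun w : ℝ => w ^ (-s)) (-s * w ^ (-s - 1)) w :=
      hasDerivAt_rpow_const (Or.inl hw.1.ne')
    have h2 : HasDerivAt (fun w : ℝ => (1 - w) ^ p - 1) (-1 * p * (1 - w) ^ (p - 1)) w :=
      (((hasDerivAt_id w).const_sub 1).rpow_const (Or.inl (by simp; linarith [hw.2]))).sub_const 1
    convert! (h1.mul h2).const_mul (-(1 / s)) using 1
    simp only [hEdef, hBdef, show 1 - s - 1 = -s by ring]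
    field_simp
    ring
  have hF0 : Tendsto F (𝓝[>] 0) (𝓝 0) := by
    have hg : Tendsto (fun w : ℝ => (1 / s) * (max p 1 * w ^ (1 - s))) (𝓝[>] 0) (𝓝 0) := by
      have : Tendsto (fun w : ℝ => w ^ (1 - s)) (𝓝 0) (𝓝 0) := by
        simpa [zero_rpow (by linarith : 1 - s ≠ 0)] using
          (continuousAt_rpow_const (0 : ℝ) (1 - s) (Or.inr (by linarith))).tendsto
      simpa using ((this.const_mul (max p 1)).const_mul (1 / s)).mono_left nhdsWithin_le_nhds
    refine squeeze_zero_norm' ?_ hg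
    filter_upwards [Ioo_mem_nhdsGT (zero_lt_one (α := ℝ))] with w hw
    have := abs_one_sub_rpow_sub_one_le hp0 (Ioo_subset_Icc_self hw)
    rw [hFdef, norm_mul, norm_neg, norm_mul, Real.norm_of_nonneg (rpow_nonneg hw.1.le _),
      Real.norm_of_nonneg (by positivity), Real.norm_eq_abs, show 1 - s = -s + 1 by ring,
      rpow_add_one hw.1.ne']
    have h3 : 0 ≤ w ^ (-s) := rpow_nonneg hw.1.le _
    calc 1 / s * (w ^ (-s) * |(1 - w) ^ p - 1|) ≤ 1 / s * (w ^ (-s) * (max p 1 * w)) := by gcongr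
      _ = _ := by ring
  have hF1 : Tendsto F (𝓝[<] 1) (𝓝 (1 / s)) := by
    have hc : ContinuousAt F 1 := by
      refine ContinuousAt.mul continuousAt_const (ContinuousAt.mul ?_ (ContinuousAt.sub ?_ ?_))
      · exact continuousAt_rpow_const _ _ (Or.inl one_ne_zero)
      · exact ContinuousAt.rpow_const (by fun_prop) (Or.inr hp0.le)
      · exact continuousAt_const
    have h := hc.tendsto
    rw [show F 1 = 1 / s by simp [hFdef, zero_rpow hp0.ne']] at h
    exact h.mono_left nhdsWithin_le_nhds
  have hFint : ∫ w in Ioo (0 : ℝ) 1, (E w + (p / s) * B w) = 1 / s := by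
    have := intervalIntegral.integral_eq_sub_of_hasDerivAt_of_tendsto zero_lt_one hderiv
      ((intervalIntegrable_iff_integrableOn_Ioo_of_le zero_le_one).2 hF'i) hF0 hF1
    rwa [intervalIntegral.integral_of_le zero_le_one, integral_Ioc_eq_integral_Ioo,
      sub_zero] at this
  have hcongr1 : ∀ w ∈ Ioo (0 : ℝ) 1,
      (E w + (p / s) * B w) + (1 - p / s) * B w = w ^ (-s - 1) * truncPowSub p w := by
    intro w hw
    have hw1 : 1 - w ≠ 0 := by linarith [hw.2]
    simp only [hEdef, hBdef, truncPowSub, if_pos hw.2, show 1 - s - 1 = -s by ring]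
    rw [rpow_sub_one hw.1.ne', rpow_sub_one hw1]
    field_simp [hw.1.ne']
    ring
  have hcongr2 : ∀ w ∈ Ici (1 : ℝ), -(w ^ (-s - 1)) = w ^ (-s - 1) * truncPowSub p w := by
    intro w hw
    simp [truncPowSub, not_lt.2 (mem_Ici.1 hw)]
  have hi1 : IntegrableOn (fun w : ℝ => w ^ (-s - 1) * truncPowSub p w) (Ioo 0 1) :=
    (show IntegrableOn _ _ from hF'i.add (hBi.const_mul (1 - p / s))).congr_fun hcongr1
      measurableSet_Ioo
  have hi2 : IntegrableOn (fun w : ℝ => w ^ (-s - 1) * truncPowSub p w) (Ici 1) := by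
    have : IntegrableOn (fun w : ℝ => -(w ^ (-s - 1))) (Ici 1) := by
      rw [integrableOn_Ici_iff_integrableOn_Ioi]
      exact (integrableOn_Ioi_rpow_of_lt (by linarith) one_pos).neg
    exact this.congr_fun hcongr2 measurableSet_Ici
  have hu : Ioi (0 : ℝ) = Ioo 0 1 ∪ Ici 1 := (Ioo_union_Ici_eq_Ioi zero_lt_one).symm
  refine ⟨by rw [hu]; exact hi1.union hi2, ?_⟩
  rw [hu, setIntegral_union _ measurableSet_Ici hi1 hi2,
    ← setIntegral_congr_fun measurableSet_Ioo hcongr1,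
    ← setIntegral_congr_fun measurableSet_Ici hcongr2, integral_add hF'i (hBi.const_mul _),
    hFint, integral_const_mul, hB, integral_neg, integral_Ici_eq_integral_Ioi,
    integral_Ioi_rpow_of_lt (by linarith) one_pos]
  · have hG1 : Real.Gamma (1 - s + p) = (p - s) * Real.Gamma (p - s) := by
      rw [← Real.Gamma_add_one (by linarith)]; ring_nf
    have hG2 : Real.Gamma (1 - s) = (-s) * Real.Gamma (-s) := by
      rw [← Real.Gamma_add_one (by linarith)]; ring_nf
    have hne : Real.Gamma (p - s) ≠ 0 := (Real.Gamma_pos_of_pos (by linarith)).ne'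
    have hps : p - s ≠ 0 := by linarith
    rw [hG1, hG2, one_rpow, show -s - 1 + 1 = -s by ring]
    field_simp
    ring
  · exact Set.disjoint_left.2 fun w hw hw' => (not_lt.2 (mem_Ici.1 hw')) hw.2

lemma rpow_mul_comp_div_eq {s τ w : ℝ} (hτ : 0 < τ) (hw : 0 < w) (K : ℝ → ℝ) :
    (|(-1 : ℝ)| * w ^ ((-1 : ℝ) - 1)) • ((w ^ (-1 : ℝ)) ^ (s - 1) * K (τ / w ^ (-1 : ℝ))) =
      τ ^ (s + 1) * ((τ * w) ^ (-s - 1) * K (τ * w)) := by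
  rw [← rpow_mul hw.le, mul_rpow hτ.le hw.le, abs_neg, abs_one, one_mul, smul_eq_mul,
    ← mul_assoc, ← rpow_add hw, rpow_neg_one w, div_inv_eq_mul, ← mul_assoc, ← mul_assoc,
    ← rpow_add hτ, show s + 1 + (-s - 1) = 0 by ring, rpow_zero, one_mul]
  ring_nf

lemma integrableOn_rpow_mul_comp_div {s τ : ℝ} (hτ : 0 < τ) {K : ℝ → ℝ}
    (hK : IntegrableOn (fun w : ℝ => w ^ (-s - 1) * K w) (Ioi 0)) :
    IntegrableOn (fun r : ℝ => r ^ (s - 1) * K (τ / r)) (Ioi 0) := by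
  rw [← integrableOn_Ioi_comp_rpow_iff _ (p := -1) (by norm_num),
    integrableOn_congr_fun (fun w (hw : w ∈ Ioi (0 : ℝ)) =>
      rpow_mul_comp_div_eq hτ hw K) measurableSet_Ioi]
  have h := (integrableOn_Ioi_comp_mul_left_iff (fun w : ℝ => w ^ (-s - 1) * K w) 0 hτ).2
    (by simpa using hK)
  exact Integrable.const_mul h _

lemma integral_rpow_mul_comp_div {s τ : ℝ} (hτ : 0 < τ) (K : ℝ → ℝ) :
    ∫ r in Ioi (0 : ℝ), r ^ (s - 1) * K (τ / r) =
      τ ^ s * ∫ w in Ioi (0 : ℝ), w ^ (-s - 1) * K w := by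
  rw [← integral_comp_rpow_Ioi _ (p := -1) (by norm_num),
    setIntegral_congr_fun measurableSet_Ioi (fun w hw => rpow_mul_comp_div_eq hτ hw K),
    integral_const_mul, integral_comp_mul_left_Ioi (fun w : ℝ => w ^ (-s - 1) * K w) 0 hτ,
    mul_zero, smul_eq_mul, ← mul_assoc, rpow_add_one hτ.ne', mul_inv_cancel_right₀ hτ.ne']

lemma integrableOn_rpow_mul_exp_neg_mul_Ioi {q a : ℝ} (hq : 0 < q) (ha : 0 < a) :
    IntegrableOn (fun t : ℝ => t ^ (q - 1) * exp (-(a * t))) (Ioi 0) := by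
  refine Integrable.of_integral_ne_zero ?_
  rw [integral_rpow_mul_exp_neg_mul_Ioi hq ha]
  have := Real.Gamma_pos_of_pos hq
  positivity

lemma integral_integral_truncPowSub {s p q a : ℝ} (hs : 0 < s) (hs1 : s < 1) (hp : s < p)
    (hq : 0 < q) (ha : 0 < a) :
    ∫ r in Ioi (0 : ℝ), r ^ (s - 1) *
        ∫ t in Ioi (0 : ℝ), t ^ (q - 1) * exp (-(a * t)) * truncPowSub p (t / r) =
      (1 / a) ^ (q + s) * Real.Gamma (q + s) *
        (Real.Gamma (-s) * Real.Gamma p / Real.Gamma (p - s)) := by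
  obtain ⟨hi, hI⟩ := integral_rpow_mul_truncPowSub hs hs1 hp
  set f : ℝ × ℝ → ℝ := fun z =>
    z.1 ^ (s - 1) * (z.2 ^ (q - 1) * exp (-(a * z.2)) * truncPowSub p (z.2 / z.1)) with hf
  have hfm : AEStronglyMeasurable f
      ((volume.restrict (Ioi (0 : ℝ))).prod (volume.restrict (Ioi (0 : ℝ)))) :=
    Measurable.aestronglyMeasurable (by rw [hf]; fun_prop)
  have hinner : ∀ t ∈ Ioi (0 : ℝ), ∫ r in Ioi (0 : ℝ), f (r, t) =
      t ^ (q + s - 1) * exp (-(a * t)) *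
        (Real.Gamma (-s) * Real.Gamma p / Real.Gamma (p - s)) := by
    intro t ht
    have : ∀ r : ℝ, f (r, t) =
        (t ^ (q - 1) * exp (-(a * t))) * (r ^ (s - 1) * truncPowSub p (t / r)) :=
      fun r => by simp only [hf]; ring
    simp_rw [this]
    rw [integral_const_mul, integral_rpow_mul_comp_div ht, hI, show q + s - 1 = q - 1 + s by ring,
      rpow_add ht]
    ring
  have hfi : Integrable f
      ((volume.restrict (Ioi (0 : ℝ))).prod (volume.restrict (Ioi (0 : ℝ)))) := by
    rw [integrable_prod_iff' hfm]
    constructor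
    · filter_upwards [ae_restrict_mem measurableSet_Ioi] with t ht
      refine ((integrableOn_rpow_mul_comp_div ht hi).const_mul
        (t ^ (q - 1) * exp (-(a * t)))).congr (Eventually.of_forall fun r => ?_)
      simp only [hf]; ring
    · have h := (integrableOn_rpow_mul_exp_neg_mul_Ioi (q := q + s) (by linarith) ha).mul_const
        (∫ w in Ioi (0 : ℝ), w ^ (-s - 1) * |truncPowSub p w|)
      refine Integrable.congr h ?_
      filter_upwards [ae_restrict_mem measurableSet_Ioi] with t ht
      have ht' : 0 < t := ht
      have : ∀ r ∈ Ioi (0 : ℝ), ‖f (r, t)‖ =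
          (t ^ (q - 1) * exp (-(a * t))) * (r ^ (s - 1) * |truncPowSub p (t / r)|) := by
        intro r hr
        simp only [hf, norm_mul, Real.norm_eq_abs, abs_exp]
        rw [abs_of_nonneg (rpow_nonneg ht'.le _), abs_of_nonneg (rpow_nonneg (le_of_lt hr) _)]
        ring
      rw [setIntegral_congr_fun measurableSet_Ioi this, integral_const_mul,
        integral_rpow_mul_comp_div ht (fun w => |truncPowSub p w|),
        show q + s - 1 = q - 1 + s by ring, rpow_add ht]
      ring
  have h1 : ∀ r : ℝ, r ^ (s - 1) *
      (∫ t in Ioi (0 : ℝ), t ^ (q - 1) * exp (-(a * t)) * truncPowSub p (t / r)) =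
        ∫ t in Ioi (0 : ℝ), f (r, t) := fun r => (integral_const_mul _ _).symm
  simp_rw [h1]
  rw [integral_integral_swap (f := fun r t => f (r, t)) hfi,
    setIntegral_congr_fun measurableSet_Ioi hinner, integral_mul_const,
    integral_rpow_mul_exp_neg_mul_Ioi (by linarith) ha]

lemma image_mul_div_sub_Ioo {r : ℝ} (hr : 0 < r) :
    (fun τ : ℝ => τ * r / (r - τ)) '' Ioo 0 r = Ioi 0 := by
  ext t
  constructor
  · rintro ⟨τ, hτ, rfl⟩
    exact div_pos (mul_pos hτ.1 hr) (sub_pos.2 hτ.2)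
  · intro ht
    have ht' : 0 < t := ht
    refine ⟨t * r / (t + r), ⟨by positivity, ?_⟩, ?_⟩
    · rw [div_lt_iff₀ (by positivity)]; nlinarith
    · have h : r - t * r / (t + r) = r * r / (t + r) := by field_simp; ring
      simp only [h]
      field_simp

lemma gaussian_mixture_sub_eq {D q r a : ℝ} (hq : 0 < q) (hr : 0 < r) (ha : 0 < a)
    (hi : IntegrableOn (fun t : ℝ => t ^ (q - 1) *
      ((π / (t + r)) ^ D * exp (-(t * r / (t + r) * a)))) (Ioi 0)) :
    (∫ t in Ioi (0 : ℝ), t ^ (q - 1) * ((π / (t + r)) ^ D * exp (-(t * r / (t + r) * a)))) -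
        (π / r) ^ D * ∫ t in Ioi (0 : ℝ), t ^ (q - 1) * exp (-(a * t)) =
      (π / r) ^ D * ∫ t in Ioi (0 : ℝ),
        t ^ (q - 1) * exp (-(a * t)) * truncPowSub (D - q) (t / r) := by
  have hder : ∀ τ ∈ Ioo 0 r, HasDerivWithinAt (fun τ : ℝ => τ * r / (r - τ))
      (1 / (1 - τ / r) ^ 2) (Ioo 0 r) τ := by
    intro τ hτ
    have hne : r - τ ≠ 0 := by linarith [hτ.2]
    have h := (((hasDerivAt_id τ).mul_const r).div ((hasDerivAt_id τ).const_sub r) hne)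
    refine HasDerivAt.hasDerivWithinAt ?_
    convert! h using 1
    have hne' : 1 - τ / r ≠ 0 := by
      rw [show 1 - τ / r = (r - τ) / r by field_simp]; exact div_ne_zero hne hr.ne'
    simp only [id]
    field_simp
    ring
  have hinj : InjOn (fun τ : ℝ => τ * r / (r - τ)) (Ioo 0 r) := by
    intro τ hτ τ' hτ' h
    have h1 : r - τ ≠ 0 := by linarith [hτ.2]
    have h2 : r - τ' ≠ 0 := by linarith [hτ'.2]
    simp only at h
    rw [div_eq_div_iff h1 h2] at h
    have : r * r * (τ - τ') = 0 := by linear_combination h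
    have := (mul_eq_zero.1 this).resolve_left (by positivity)
    linarith
  have hpt : ∀ τ ∈ Ioo 0 r, |1 / (1 - τ / r) ^ 2| • ((τ * r / (r - τ)) ^ (q - 1) *
      ((π / (τ * r / (r - τ) + r)) ^ D *
        exp (-(τ * r / (r - τ) * r / (τ * r / (r - τ) + r) * a)))) =
      (π / r) ^ D * (τ ^ (q - 1) * exp (-(a * τ)) * (1 - τ / r) ^ (D - q - 1)) := by
    intro τ hτ
    have hτ0 := hτ.1
    have hne : 0 < r - τ := by linarith [hτ.2]
    obtain ⟨m, hm⟩ : ∃ m, m = 1 - τ / r := ⟨_, rfl⟩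
    have hm' : m = (r - τ) / r := by rw [hm]; field_simp
    have hm0 : 0 < m := by rw [hm']; positivity
    have e1 : τ * r / (r - τ) = τ / m := by rw [hm']; field_simp
    have e2 : τ * r / (r - τ) + r = r / m := by rw [hm']; field_simp; ring
    rw [e2, e1, ← hm, show τ / m * r / (r / m) * a = a * τ by field_simp,
      show π / (r / m) = π / r * m by field_simp, mul_rpow (by positivity) hm0.le,
      div_rpow hτ0.le hm0.le, abs_of_pos (by positivity), smul_eq_mul,
      show D - q - 1 = D - (q - 1) - 2 by ring, rpow_sub hm0 (D - (q - 1)) 2,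
      rpow_sub hm0 D (q - 1), rpow_two]
    field_simp
  have hI1 := integral_image_eq_integral_abs_deriv_smul measurableSet_Ioo hder hinj
    (fun t : ℝ => t ^ (q - 1) * ((π / (t + r)) ^ D * exp (-(t * r / (t + r) * a))))
  have hi1 := (integrableOn_image_iff_integrableOn_abs_deriv_smul measurableSet_Ioo hder hinj
    (fun t : ℝ => t ^ (q - 1) * ((π / (t + r)) ^ D * exp (-(t * r / (t + r) * a))))).1
    (by rwa [image_mul_div_sub_Ioo hr])
  rw [image_mul_div_sub_Ioo hr, setIntegral_congr_fun measurableSet_Ioo hpt,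
    integral_const_mul] at hI1
  rw [integrableOn_congr_fun hpt measurableSet_Ioo] at hi1
  have hc : (π / r) ^ D ≠ 0 := by positivity
  have hi2 : IntegrableOn (fun τ : ℝ => τ ^ (q - 1) * exp (-(a * τ)) *
      (1 - τ / r) ^ (D - q - 1)) (Ioo 0 r) := by
    refine (Integrable.const_mul hi1 ((π / r) ^ D)⁻¹).congr (Eventually.of_forall fun τ => ?_)
    simp only [inv_mul_cancel_left₀ hc]
  have hcut : ∀ τ ∈ Ioi (0 : ℝ), (Ioo 0 r).indicator (fun τ : ℝ => τ ^ (q - 1) *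
      exp (-(a * τ)) * (1 - τ / r) ^ (D - q - 1)) τ - τ ^ (q - 1) * exp (-(a * τ)) =
      τ ^ (q - 1) * exp (-(a * τ)) * truncPowSub (D - q) (τ / r) := by
    intro τ hτ
    by_cases h : τ < r
    · rw [indicator_of_mem (show τ ∈ Ioo 0 r from ⟨hτ, h⟩), truncPowSub,
        if_pos ((div_lt_one hr).2 h)]
      ring
    · rw [indicator_of_notMem (fun h' => h h'.2), truncPowSub,
        if_neg (fun h' => h ((div_lt_one hr).1 h'))]
      ring
  rw [hI1, ← mul_sub, ← setIntegral_congr_fun measurableSet_Ioi hcut, integral_sub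
    ((integrable_indicator_iff measurableSet_Ioo).2 hi2).integrableOn
    (integrableOn_rpow_mul_exp_neg_mul_Ioi hq ha),
    setIntegral_indicator measurableSet_Ioo, inter_eq_right.2 Ioo_subset_Ioi_self]

/-- The symmetric second difference of `‖·‖ ^ (-b)` at `x` with increment `z`. -/
noncomputable def secondDiffNormRpow {E : Type*} [NormedAddCommGroup E] (b : ℝ) (x z : E) : ℝ :=
  ‖x + z‖ ^ (-b) + ‖x - z‖ ^ (-b) - 2 * ‖x‖ ^ (-b)

lemma secondDiffNormRpow_zero {E : Type*} [NormedAddCommGroup E] (b : ℝ) (x : E) :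
    secondDiffNormRpow b x 0 = 0 := by
  simp [secondDiffNormRpow]; ring

lemma exists_rpow_sub_affine_le {a p : ℝ} (ha : 0 < a) :
    ∃ m C δ : ℝ, 0 ≤ C ∧ 0 < δ ∧ ∀ h : ℝ, |h| < δ →
      |(a + h) ^ p - a ^ p - m * h| ≤ C * h ^ 2 := by
  have han : AnalyticAt ℝ (fun v : ℝ => v ^ p) a :=
    (Real.contDiffAt_rpow_const_of_ne ha.ne').analyticAt
  obtain ⟨P, hP⟩ := han
  obtain ⟨C, hC0, hC⟩ := (hP.isBigO_sub_partialSum_pow 2).exists_nonneg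
  obtain ⟨δ, hδ, hδC⟩ := Metric.eventually_nhds_iff.1 hC.bound
  refine ⟨P.coeff 1, C, δ, hC0, hδ, fun h hh => ?_⟩
  have h1 := hδC (show dist h 0 < δ by simpa using hh)
  have h0 : P.coeff 0 = a ^ p := hP.coeff_zero _
  simp only [FormalMultilinearSeries.partialSum, Finset.sum_range_succ, Finset.sum_range_zero,
    FormalMultilinearSeries.apply_eq_pow_smul_coeff, h0, smul_eq_mul, Real.norm_eq_abs, pow_zero,
    pow_one, one_mul, zero_add, abs_pow, sq_abs] at h1
  convert! h1 using 2
  ring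

lemma exists_secondDiffNormRpow_le {E : Type*} [NormedAddCommGroup E] [InnerProductSpace ℝ E]
    (b : ℝ) {x : E} (hx : x ≠ 0) :
    ∃ C δ : ℝ, 0 < δ ∧ ∀ z : E, ‖z‖ < δ → |secondDiffNormRpow b x z| ≤ C * ‖z‖ ^ 2 := by
  have hx0 : 0 < ‖x‖ := norm_pos_iff.2 hx
  obtain ⟨m, C, δ, hC, hδ, H⟩ := exists_rpow_sub_affine_le (p := -b / 2) (a := ‖x‖ ^ 2)
    (by positivity)
  have hpow : ∀ y : E, ‖y‖ ^ (-b) = (‖y‖ ^ 2) ^ (-b / 2) := fun y => by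
    rw [← rpow_natCast, ← rpow_mul (norm_nonneg _)]; congr 1; push_cast; ring
  have key : ∀ z : E, ‖z‖ < 1 → ∀ i : ℝ, |i| ≤ ‖x‖ * ‖z‖ →
      |2 * i + ‖z‖ ^ 2| ≤ (2 * ‖x‖ + 1) * ‖z‖ := by
    intro z hz i hi
    have := norm_nonneg z
    rw [abs_le] at hi ⊢
    constructor <;> nlinarith
  refine ⟨2 * |m| + 2 * (C * (2 * ‖x‖ + 1) ^ 2), min 1 (δ / (2 * ‖x‖ + 1)), by positivity,
    fun z hz => ?_⟩
  have hz1 : ‖z‖ < 1 := hz.trans_le (min_le_left _ _)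
  have hz2 : (2 * ‖x‖ + 1) * ‖z‖ < δ := by
    have := hz.trans_le (min_le_right _ _)
    rw [lt_div_iff₀ (by positivity)] at this
    linarith
  have hin : |inner ℝ x z| ≤ ‖x‖ * ‖z‖ := abs_real_inner_le_norm x z
  have k1 := key z hz1 _ hin
  have k2 := key z hz1 (-inner ℝ x z) (by rwa [abs_neg])
  have H1 := H _ (k1.trans_lt hz2)
  have H2 := H _ (k2.trans_lt hz2)
  have s1 := mul_le_mul_of_nonneg_left (sq_le_sq' (abs_le.1 k1).1 (abs_le.1 k1).2) hC
  have s2 := mul_le_mul_of_nonneg_left (sq_le_sq' (abs_le.1 k2).1 (abs_le.1 k2).2) hC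
  have e1 : ‖x + z‖ ^ 2 = ‖x‖ ^ 2 + (2 * inner ℝ x z + ‖z‖ ^ 2) := by
    rw [norm_add_sq_real]; ring
  have e2 : ‖x - z‖ ^ 2 = ‖x‖ ^ 2 + (2 * -inner ℝ x z + ‖z‖ ^ 2) := by
    rw [norm_sub_sq_real]; ring
  rw [secondDiffNormRpow, hpow, hpow, hpow, e1, e2]
  have hm : |2 * (m * ‖z‖ ^ 2)| = 2 * |m| * ‖z‖ ^ 2 := by
    rw [abs_mul, abs_mul, abs_of_nonneg (by positivity : 0 ≤ ‖z‖ ^ 2), abs_two]; ring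
  have hm' := abs_le.1 hm.le
  rw [abs_le] at H1 H2 ⊢
  constructor <;> nlinarith [H1.1, H1.2, H2.1, H2.2]

lemma gaussian_mul_gaussian_eq {E : Type*} [NormedAddCommGroup E] [InnerProductSpace ℝ E]
    {t r : ℝ} (ht : 0 < t) (hr : 0 < r) (x z : E) :
    exp (-(t * ‖x + z‖ ^ 2)) * exp (-(r * ‖z‖ ^ 2)) =
      exp (-(t * r / (t + r) * ‖x‖ ^ 2)) * exp (-(t + r) * ‖z + (t / (t + r)) • x‖ ^ 2) := by
  have h : t + r ≠ 0 := by positivity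
  rw [← exp_add, ← exp_add]
  congr 1
  rw [norm_add_sq_real, norm_add_sq_real, real_inner_smul_right, norm_smul,
    Real.norm_of_nonneg (by positivity), real_inner_comm]
  field_simp
  ring

lemma integral_rpow_mul_exp_neg_mul_norm_sq {E : Type*} [NormedAddCommGroup E]
    {p : ℝ} (hp : 0 < p) {z : E} (hz : z ≠ 0) :
    ∫ t in Ioi (0 : ℝ), t ^ (p / 2 - 1) * exp (-(t * ‖z‖ ^ 2)) =
      Real.Gamma (p / 2) * ‖z‖ ^ (-p) := by
  have hz' : 0 < ‖z‖ := norm_pos_iff.2 hz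
  simp_rw [mul_comm _ (‖z‖ ^ 2)]
  rw [integral_rpow_mul_exp_neg_mul_Ioi (by positivity) (by positivity), mul_comm, one_div,
    ← rpow_natCast, ← rpow_neg hz'.le, ← rpow_mul hz'.le]
  congr 2
  push_cast
  ring

lemma integrableOn_rpow_mul_exp_neg_mul_norm_sq {E : Type*} [NormedAddCommGroup E]
    {p : ℝ} (hp : 0 < p) {z : E} (hz : z ≠ 0) :
    IntegrableOn (fun t : ℝ => t ^ (p / 2 - 1) * exp (-(t * ‖z‖ ^ 2))) (Ioi 0) := by
  have hz' : 0 < ‖z‖ := norm_pos_iff.2 hz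
  simp_rw [mul_comm _ (‖z‖ ^ 2)]
  exact integrableOn_rpow_mul_exp_neg_mul_Ioi (by positivity) (by positivity)

lemma pow_finrank_sub_one_smul_rpow {E : Type*} [NormedAddCommGroup E]
    [InnerProductSpace ℝ E] [FiniteDimensional ℝ E] [Nontrivial E] {y p : ℝ} (hy : 0 < y) :
    y ^ (Module.finrank ℝ E - 1) • y ^ p = y ^ (Module.finrank ℝ E - 1 + p : ℝ) := by
  have h : 1 ≤ Module.finrank ℝ E := Module.finrank_pos
  rw [smul_eq_mul, ← rpow_natCast, ← rpow_add hy, Nat.cast_sub h, Nat.cast_one]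

section NormPower

variable {E : Type*} [NormedAddCommGroup E] [InnerProductSpace ℝ E] [FiniteDimensional ℝ E]
  [MeasurableSpace E] [BorelSpace E]

lemma integrable_exp_neg_mul_norm_sq {r : ℝ} (hr : 0 < r) :
    Integrable (fun z : E => exp (-(r * ‖z‖ ^ 2))) := by
  refine Integrable.of_integral_ne_zero ?_
  have h := GaussianFourier.integral_rexp_neg_mul_sq_norm (V := E) hr
  simp only [neg_mul] at h
  rw [h]
  positivity

lemma integrable_gaussian_mul_gaussian {t r : ℝ} (ht : 0 < t) (hr : 0 < r) (x : E) :
    Integrable (fun z : E => exp (-(t * ‖x + z‖ ^ 2)) * exp (-(r * ‖z‖ ^ 2))) := by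
  simp_rw [gaussian_mul_gaussian_eq ht hr]
  refine Integrable.const_mul ?_ _
  have h := (integrable_exp_neg_mul_norm_sq (E := E) (add_pos ht hr)).comp_add_right
    ((t / (t + r)) • x)
  simpa only [neg_mul] using h

lemma integral_gaussian_mul_gaussian {t r : ℝ} (ht : 0 < t) (hr : 0 < r) (x : E) :
    ∫ z : E, exp (-(t * ‖x + z‖ ^ 2)) * exp (-(r * ‖z‖ ^ 2)) =
      (π / (t + r)) ^ (Module.finrank ℝ E / 2 : ℝ) * exp (-(t * r / (t + r) * ‖x‖ ^ 2)) := by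
  simp_rw [gaussian_mul_gaussian_eq ht hr]
  rw [integral_const_mul, integral_add_right_eq_self
    (fun z : E => exp (-(t + r) * ‖z‖ ^ 2)) ((t / (t + r)) • x),
    GaussianFourier.integral_rexp_neg_mul_sq_norm (add_pos ht hr), mul_comm]

variable [Nontrivial E]

lemma integrableOn_norm_rpow_ball {p : ℝ} (hp : -(Module.finrank ℝ E : ℝ) < p) (δ : ℝ) :
    IntegrableOn (fun z : E => ‖z‖ ^ p) (Metric.ball 0 δ) := by
  rw [integrableOn_fun_norm_addHaar (E := E) volume (f := fun y : ℝ => y ^ p)]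
  rcases le_or_gt δ 0 with hδ | hδ
  · simp [Ioo_eq_empty (not_lt.2 hδ)]
  rw [integrableOn_congr_fun (fun y (hy : y ∈ Ioo 0 δ) =>
    pow_finrank_sub_one_smul_rpow (E := E) hy.1)
    measurableSet_Ioo, ← intervalIntegrable_iff_integrableOn_Ioo_of_le hδ.le]
  exact intervalIntegral.intervalIntegrable_rpow' (by linarith)

lemma integrableOn_norm_rpow_compl_ball {p δ : ℝ} (hp : p < -(Module.finrank ℝ E : ℝ))
    (hδ : 0 < δ) : IntegrableOn (fun z : E => ‖z‖ ^ p) (Metric.ball 0 δ)ᶜ := by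
  have hi : Integrable (fun z : E => (Ici δ).indicator (fun y : ℝ => y ^ p) ‖z‖) := by
    rw [integrable_fun_norm_addHaar (E := E) volume (f := (Ici δ).indicator fun y : ℝ => y ^ p)]
    have h : IntegrableOn (fun y : ℝ => y ^ (Module.finrank ℝ E - 1 + p : ℝ)) (Ici δ) := by
      rw [integrableOn_Ici_iff_integrableOn_Ioi]
      exact integrableOn_Ioi_rpow_of_lt (by linarith) hδ
    refine ((integrable_indicator_iff measurableSet_Ici).2 h).integrableOn.congr_fun
      (fun y hy => ?_) measurableSet_Ioi
    by_cases hyδ : y ∈ Ici δ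
    · simp only [indicator_of_mem hyδ]
      exact (pow_finrank_sub_one_smul_rpow (E := E) hy).symm
    · simp [indicator_of_notMem hyδ]
  rw [← integrable_indicator_iff measurableSet_ball.compl]
  refine hi.congr (Eventually.of_forall fun z => ?_)
  by_cases h : δ ≤ ‖z‖ <;> simp [indicator, h]

lemma integrable_norm_add_rpow_mul {b M : ℝ} (hb : 0 < b) (hb' : b < Module.finrank ℝ E)
    {k : E → ℝ} (hk : Integrable k) (hkm : Measurable k) (hM : ∀ z, |k z| ≤ M) (x : E) :
    Integrable (fun z : E => ‖x + z‖ ^ (-b) * k z) := by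
  have h1 : Integrable ((Metric.ball (0 : E) 1).indicator fun z => ‖z‖ ^ (-b)) :=
    (integrable_indicator_iff measurableSet_ball).2 (integrableOn_norm_rpow_ball (by linarith) 1)
  refine ((((h1.comp_add_left x).const_mul M)).add hk.norm).mono'
    (Measurable.aestronglyMeasurable (by fun_prop)) (Eventually.of_forall fun z => ?_)
  have hu : 0 ≤ ‖x + z‖ ^ (-b) := by positivity
  rw [norm_mul, Real.norm_of_nonneg hu, Pi.add_apply, Real.norm_eq_abs]
  by_cases h : x + z ∈ Metric.ball (0 : E) 1
  · rw [indicator_of_mem h]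
    have := mul_le_mul_of_nonneg_left (hM z) hu
    linarith [abs_nonneg (k z)]
  · rw [indicator_of_notMem h]
    have h' : 1 ≤ ‖x + z‖ := by simpa using h
    have := mul_le_mul_of_nonneg_right (rpow_le_one_of_one_le_of_nonpos h' (by linarith : -b ≤ 0))
      (abs_nonneg (k z))
    linarith

lemma integral_norm_add_rpow_mul_gaussian {b r : ℝ} (hb : 0 < b) (hb' : b < Module.finrank ℝ E)
    (hr : 0 < r) (x : E) :
    IntegrableOn (fun t : ℝ => t ^ (b / 2 - 1) * ((π / (t + r)) ^ (Module.finrank ℝ E / 2 : ℝ) *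
        exp (-(t * r / (t + r) * ‖x‖ ^ 2)))) (Ioi 0) ∧
      Real.Gamma (b / 2) * ∫ z : E, ‖x + z‖ ^ (-b) * exp (-(r * ‖z‖ ^ 2)) =
        ∫ t in Ioi (0 : ℝ), t ^ (b / 2 - 1) * ((π / (t + r)) ^ (Module.finrank ℝ E / 2 : ℝ) *
          exp (-(t * r / (t + r) * ‖x‖ ^ 2))) := by
  set f : E → ℝ → ℝ := fun z t =>
    t ^ (b / 2 - 1) * (exp (-(t * ‖x + z‖ ^ 2)) * exp (-(r * ‖z‖ ^ 2))) with hf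
  have hne : ∀ᵐ z : E, x + z ≠ 0 := by
    filter_upwards [compl_mem_ae_iff.2 (measure_singleton (-x))] with z hz h
    exact hz (eq_neg_of_add_eq_zero_right h)
  have hfz : ∀ᵐ z : E, ∫ t in Ioi (0 : ℝ), f z t =
      Real.Gamma (b / 2) * (‖x + z‖ ^ (-b) * exp (-(r * ‖z‖ ^ 2))) := by
    filter_upwards [hne] with z hz
    simp only [hf, ← mul_assoc]
    rw [integral_mul_const, integral_rpow_mul_exp_neg_mul_norm_sq hb hz]
  have hG : Integrable (fun z : E => ‖x + z‖ ^ (-b) * exp (-(r * ‖z‖ ^ 2))) := by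
    refine integrable_norm_add_rpow_mul (M := 1) hb hb' (integrable_exp_neg_mul_norm_sq hr)
      (by fun_prop) (fun z => ?_) x
    rw [abs_exp, exp_le_one_iff]
    have : 0 ≤ r * ‖z‖ ^ 2 := by positivity
    linarith
  have hfi : Integrable (Function.uncurry f)
      ((volume : Measure E).prod (volume.restrict (Ioi (0 : ℝ)))) := by
    rw [integrable_prod_iff (Measurable.aestronglyMeasurable (by
      simp only [hf, Function.uncurry_def]; fun_prop))]
    constructor
    · filter_upwards [hne] with z hz
      refine ((integrableOn_rpow_mul_exp_neg_mul_norm_sq hb hz).mul_const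
        (exp (-(r * ‖z‖ ^ 2)))).congr (Eventually.of_forall fun t => ?_)
      simp only [hf, Function.uncurry_apply_pair]; ring
    · refine (hG.const_mul (Real.Gamma (b / 2))).congr ?_
      filter_upwards [hfz] with z hz
      rw [← hz]
      refine setIntegral_congr_fun measurableSet_Ioi fun t ht => ?_
      simp only [Function.uncurry_apply_pair]
      rw [Real.norm_of_nonneg]
      exact mul_nonneg (rpow_nonneg (le_of_lt ht) _) (by positivity)
  have hft : ∀ t ∈ Ioi (0 : ℝ), ∫ z : E, f z t = t ^ (b / 2 - 1) *
      ((π / (t + r)) ^ (Module.finrank ℝ E / 2 : ℝ) * exp (-(t * r / (t + r) * ‖x‖ ^ 2))) := by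
    intro t ht
    simp only [hf]
    rw [integral_const_mul, integral_gaussian_mul_gaussian ht hr]
  constructor
  · exact (show IntegrableOn _ _ volume from hfi.integral_prod_right).congr_fun hft
      measurableSet_Ioi
  · rw [← integral_const_mul, ← integral_congr_ae hfz, integral_integral_swap hfi]
    exact setIntegral_congr_fun measurableSet_Ioi hft

lemma integrable_norm_sub_rpow_mul {b M : ℝ} (hb : 0 < b) (hb' : b < Module.finrank ℝ E)
    {k : E → ℝ} (hk : Integrable k) (hkm : Measurable k) (hM : ∀ z, |k z| ≤ M) (x : E) :
    Integrable (fun z : E => ‖x - z‖ ^ (-b) * k z) := by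
  have h := (integrable_norm_add_rpow_mul hb hb' hk.comp_neg (by fun_prop) (fun z => hM (-z))
    x).comp_neg
  simpa only [neg_neg, ← sub_eq_add_neg] using h

lemma integral_secondDiffNormRpow_mul {b M : ℝ} (hb : 0 < b) (hb' : b < Module.finrank ℝ E)
    {k : E → ℝ} (hk : Integrable k) (hkm : Measurable k) (hM : ∀ z, |k z| ≤ M)
    (hkneg : ∀ z, k (-z) = k z) (x : E) :
    Integrable (fun z : E => secondDiffNormRpow b x z * k z) ∧
      ∫ z : E, secondDiffNormRpow b x z * k z =
        2 * ∫ z : E, (‖x + z‖ ^ (-b) - ‖x‖ ^ (-b)) * k z := by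
  have h1 : Integrable (fun z : E => (‖x + z‖ ^ (-b) - ‖x‖ ^ (-b)) * k z) := by
    simp_rw [sub_mul]
    exact (integrable_norm_add_rpow_mul hb hb' hk hkm hM x).sub (hk.const_mul _)
  have h2 : Integrable (fun z : E => (‖x - z‖ ^ (-b) - ‖x‖ ^ (-b)) * k z) := by
    simp_rw [sub_mul]
    exact (integrable_norm_sub_rpow_mul hb hb' hk hkm hM x).sub (hk.const_mul _)
  have h3 : ∫ z : E, (‖x - z‖ ^ (-b) - ‖x‖ ^ (-b)) * k z =
      ∫ z : E, (‖x + z‖ ^ (-b) - ‖x‖ ^ (-b)) * k z := by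
    rw [← integral_neg_eq_self]
    simp only [sub_neg_eq_add, hkneg]
  have e : (fun z : E => secondDiffNormRpow b x z * k z) = fun z =>
      (‖x + z‖ ^ (-b) - ‖x‖ ^ (-b)) * k z + (‖x - z‖ ^ (-b) - ‖x‖ ^ (-b)) * k z := by
    ext z; rw [secondDiffNormRpow]; ring
  rw [e]
  refine ⟨h1.add h2, ?_⟩
  rw [integral_add h1 h2, h3]
  ring

lemma rpow_indicator_compl_ball_bounds {p δ : ℝ} (hp : p < -(Module.finrank ℝ E : ℝ))
    (hδ : 0 < δ) :
    Integrable ((Metric.ball (0 : E) δ)ᶜ.indicator fun z => ‖z‖ ^ p) ∧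
      Measurable ((Metric.ball (0 : E) δ)ᶜ.indicator fun z => ‖z‖ ^ p) ∧
      ∀ z, |(Metric.ball (0 : E) δ)ᶜ.indicator (fun z => ‖z‖ ^ p) z| ≤ δ ^ p := by
  refine ⟨(integrable_indicator_iff measurableSet_ball.compl).2
    (integrableOn_norm_rpow_compl_ball hp hδ),
    Measurable.indicator (by fun_prop) measurableSet_ball.compl, fun z => ?_⟩
  by_cases h : z ∈ (Metric.ball (0 : E) δ)ᶜ
  · rw [indicator_of_mem h, abs_of_nonneg (by positivity)]
    exact rpow_le_rpow_of_nonpos hδ (by simpa using h)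
      (by linarith [(Module.finrank ℝ E).cast_nonneg (α := ℝ)])
  · rw [indicator_of_notMem h, abs_zero]
    positivity

lemma integrable_secondDiffNormRpow_mul_rpow {b p : ℝ} (hb : 0 < b)
    (hb' : b < Module.finrank ℝ E) (hp : p < -(Module.finrank ℝ E : ℝ))
    (hp2 : -(Module.finrank ℝ E : ℝ) < p + 2) {x : E} (hx : x ≠ 0) :
    Integrable (fun z : E => secondDiffNormRpow b x z * ‖z‖ ^ p) := by
  obtain ⟨C, δ, hδ, hC⟩ := exists_secondDiffNormRpow_le b hx
  rw [← integrableOn_univ, ← union_compl_self (Metric.ball (0 : E) δ)]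
  refine IntegrableOn.union ?_ ?_
  · refine Integrable.mono' ((integrableOn_norm_rpow_ball hp2 δ).const_mul C)
      (Measurable.aestronglyMeasurable (by simp only [secondDiffNormRpow]; fun_prop)) ?_
    filter_upwards [ae_restrict_mem measurableSet_ball] with z hz
    rcases eq_or_ne z 0 with rfl | hz0
    · rw [secondDiffNormRpow_zero, zero_mul, norm_zero, norm_zero]
      rcases eq_or_ne (p + 2) 0 with h | h
      · obtain ⟨w, hw0, hw⟩ : ∃ w : E, w ≠ 0 ∧ ‖w‖ < δ := by
          obtain ⟨v, hv⟩ := exists_norm_eq E (half_pos hδ).le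
          exact ⟨v, by rintro rfl; simp at hv; linarith, by linarith⟩
        have hw2 : 0 < ‖w‖ ^ 2 := by have := norm_pos_iff.2 hw0; positivity
        have := (abs_nonneg _).trans (hC w hw)
        rw [h, rpow_zero, mul_one]
        exact nonneg_of_mul_nonneg_left this hw2
      · rw [zero_rpow h, mul_zero]
    · have hz' : 0 < ‖z‖ := norm_pos_iff.2 hz0
      rw [norm_mul, Real.norm_of_nonneg (rpow_nonneg hz'.le p), Real.norm_eq_abs, rpow_add hz',
        rpow_two]
      have := mul_le_mul_of_nonneg_right (hC z (by simpa using hz)) (rpow_nonneg hz'.le p)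
      linarith
  · rw [← integrable_indicator_iff measurableSet_ball.compl]
    obtain ⟨h1, h2, h3⟩ := rpow_indicator_compl_ball_bounds (E := E) hp hδ
    have h := (integral_secondDiffNormRpow_mul hb hb' h1 h2 h3
      (fun z => by simp [indicator]) x).1
    exact h.congr (Eventually.of_forall fun z => (indicator_mul_right _ _ _).symm)

lemma tendsto_truncated_integral {b p : ℝ} (hb : 0 < b) (hb' : b < Module.finrank ℝ E)
    (hp : p < -(Module.finrank ℝ E : ℝ)) (hp2 : -(Module.finrank ℝ E : ℝ) < p + 2) {x : E}
    (hx : x ≠ 0) :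
    Tendsto (fun ε : ℝ => ∫ y in {y : E | ε < dist x y}, (‖y‖ ^ (-b) - ‖x‖ ^ (-b)) * ‖x - y‖ ^ p)
      (𝓝[>] 0) (𝓝 (1 / 2 * ∫ z : E, secondDiffNormRpow b x z * ‖z‖ ^ p)) := by
  have hi := integrable_secondDiffNormRpow_mul_rpow hb hb' hp hp2 hx
  have hmeas : ∀ ε : ℝ, MeasurableSet {z : E | ε < ‖z‖} :=
    fun ε => measurableSet_lt measurable_const measurable_norm
  have hlim : Tendsto (fun ε : ℝ => ∫ z : E, {z : E | ε < ‖z‖}.indicator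
      (fun z => secondDiffNormRpow b x z * ‖z‖ ^ p) z) (𝓝[>] 0)
      (𝓝 (∫ z : E, secondDiffNormRpow b x z * ‖z‖ ^ p)) := by
    refine tendsto_integral_filter_of_dominated_convergence _
      (Eventually.of_forall fun ε => hi.aestronglyMeasurable.indicator (hmeas ε))
      (Eventually.of_forall fun ε => Eventually.of_forall fun z => norm_indicator_le_norm_self _ _)
      hi.norm (Eventually.of_forall fun z => ?_)
    rcases eq_or_ne z 0 with rfl | hz
    · refine tendsto_const_nhds.congr fun ε => ?_
      simp [indicator_apply, secondDiffNormRpow_zero]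
    · refine tendsto_const_nhds.congr' ?_
      filter_upwards [Ioo_mem_nhdsGT (norm_pos_iff.2 hz)] with ε hε
      exact (indicator_of_mem (s := {z : E | ε < ‖z‖}) hε.2
        (fun z => secondDiffNormRpow b x z * ‖z‖ ^ p)).symm
  refine (hlim.const_mul (1 / 2)).congr' ?_
  filter_upwards [self_mem_nhdsWithin] with ε hε
  have hε' : 0 < ε := hε
  set k : E → ℝ := {z : E | ε < ‖z‖}.indicator fun z => ‖z‖ ^ p with hk
  obtain ⟨h1, -, h3⟩ := rpow_indicator_compl_ball_bounds (E := E) hp hε'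
  have hkle : ∀ z, |k z| ≤ |(Metric.ball (0 : E) ε)ᶜ.indicator (fun z => ‖z‖ ^ p) z| := by
    intro z
    by_cases h : ε < ‖z‖
    · rw [hk, indicator_of_mem (s := {z : E | ε < ‖z‖}) h,
        indicator_of_mem (show z ∈ (Metric.ball (0 : E) ε)ᶜ by simpa using h.le)]
    · rw [hk, indicator_of_notMem (s := {z : E | ε < ‖z‖}) h, abs_zero]
      positivity
  have hkm : Measurable k := Measurable.indicator (by fun_prop) (hmeas ε)
  have hki : Integrable k := h1.mono hkm.aestronglyMeasurable (Eventually.of_forall hkle)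
  have h := (integral_secondDiffNormRpow_mul hb hb' hki hkm (fun z => (hkle z).trans (h3 z))
    (fun z => by simp [hk, indicator]) x).2
  have e1 : ∀ z, {z : E | ε < ‖z‖}.indicator (fun z => secondDiffNormRpow b x z * ‖z‖ ^ p) z =
      secondDiffNormRpow b x z * k z := fun z => indicator_mul_right _ _ _
  have hmeas' : MeasurableSet {y : E | ε < dist x y} :=
    measurableSet_lt measurable_const (by fun_prop)
  simp_rw [e1]
  rw [h, ← integral_indicator hmeas', ← integral_add_left_eq_self
    ({y : E | ε < dist x y}.indicator fun y => (‖y‖ ^ (-b) - ‖x‖ ^ (-b)) * ‖x - y‖ ^ p) x,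
    ← mul_assoc,
    one_div, inv_mul_cancel₀ two_ne_zero, one_mul]
  refine integral_congr_ae (Eventually.of_forall fun z => ?_)
  simp [hk, indicator_apply, dist_eq_norm]

lemma integral_secondDiffNormRpow_mul_rpow {b s : ℝ} (hb : 0 < b) (hs : 0 < s) (hs1 : s < 1)
    (hbs : b < Module.finrank ℝ E - 2 * s) {x : E} (hx : x ≠ 0) :
    1 / 2 * ∫ z : E, secondDiffNormRpow b x z * ‖z‖ ^ (-(Module.finrank ℝ E + 2 * s : ℝ)) =
      π ^ (Module.finrank ℝ E / 2 : ℝ) * Real.Gamma ((b + 2 * s) / 2) *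
        Real.Gamma ((Module.finrank ℝ E - b) / 2) * Real.Gamma (-s) /
        (Real.Gamma ((Module.finrank ℝ E + 2 * s) / 2) *
          Real.Gamma ((Module.finrank ℝ E - b - 2 * s) / 2) * Real.Gamma (b / 2)) *
        ‖x‖ ^ (-b - 2 * s) := by
  obtain ⟨n, hn⟩ : ∃ n : ℝ, n = Module.finrank ℝ E := ⟨_, rfl⟩
  have hn1 : 1 ≤ n := by rw [hn]; exact_mod_cast Module.finrank_pos
  have hbn : b < Module.finrank ℝ E := by linarith
  have hx0 : 0 < ‖x‖ := norm_pos_iff.2 hx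
  have hi := integrable_secondDiffNormRpow_mul_rpow (p := -(Module.finrank ℝ E + 2 * s : ℝ))
    hb hbn (by linarith) (by linarith) hx
  rw [← hn] at hi hbs ⊢
  have hG1 := Real.Gamma_pos_of_pos (show 0 < (n + 2 * s) / 2 by linarith)
  have hG2 := Real.Gamma_pos_of_pos (show 0 < b / 2 by linarith)
  set f : E → ℝ → ℝ := fun z r =>
    secondDiffNormRpow b x z * (r ^ ((n + 2 * s) / 2 - 1) * exp (-(r * ‖z‖ ^ 2))) with hf
  have hfz : ∀ z : E, ∫ r in Ioi (0 : ℝ), f z r =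
      Real.Gamma ((n + 2 * s) / 2) * (secondDiffNormRpow b x z * ‖z‖ ^ (-(n + 2 * s))) := by
    intro z
    simp only [hf]
    rw [integral_const_mul]
    rcases eq_or_ne z 0 with rfl | hz
    · simp [secondDiffNormRpow_zero]
    · rw [integral_rpow_mul_exp_neg_mul_norm_sq (by linarith) hz]; ring
  have hfi : Integrable (Function.uncurry f)
      ((volume : Measure E).prod (volume.restrict (Ioi (0 : ℝ)))) := by
    rw [integrable_prod_iff (Measurable.aestronglyMeasurable (by
      simp only [hf, Function.uncurry_def, secondDiffNormRpow]; fun_prop))]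
    constructor
    · refine Eventually.of_forall fun z => ?_
      simp only [hf, Function.uncurry_apply_pair]
      rcases eq_or_ne z 0 with rfl | hz
      · simp [secondDiffNormRpow_zero]
      · exact (integrableOn_rpow_mul_exp_neg_mul_norm_sq (by linarith) hz).const_mul _
    · refine (hi.norm.const_mul (Real.Gamma ((n + 2 * s) / 2))).congr
        (Eventually.of_forall fun z => ?_)
      have e : ∀ r ∈ Ioi (0 : ℝ), ‖Function.uncurry f (z, r)‖ = |secondDiffNormRpow b x z| *
          (r ^ ((n + 2 * s) / 2 - 1) * exp (-(r * ‖z‖ ^ 2))) := by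
        intro r hr
        simp only [hf, Function.uncurry_apply_pair]
        rw [norm_mul, Real.norm_eq_abs, Real.norm_of_nonneg]
        exact mul_nonneg (rpow_nonneg (le_of_lt hr) _) (by positivity)
      simp only
      rw [setIntegral_congr_fun measurableSet_Ioi e, integral_const_mul, norm_mul,
        Real.norm_eq_abs]
      rcases eq_or_ne z 0 with rfl | hz
      · simp [secondDiffNormRpow_zero]
      · rw [integral_rpow_mul_exp_neg_mul_norm_sq (by linarith) hz,
          Real.norm_of_nonneg (by positivity)]
        ring
  have hft : ∀ r ∈ Ioi (0 : ℝ), ∫ z : E, f z r = 2 * (π ^ (n / 2) / Real.Gamma (b / 2)) *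
      (r ^ (s - 1) * ∫ t in Ioi (0 : ℝ),
        t ^ (b / 2 - 1) * exp (-(‖x‖ ^ 2 * t)) * truncPowSub (n / 2 - b / 2) (t / r)) := by
    intro r hr
    have hr' : 0 < r := hr
    have hgle : ∀ z : E, |exp (-(r * ‖z‖ ^ 2))| ≤ 1 := by
      intro z
      rw [abs_exp, exp_le_one_iff]
      have : 0 ≤ r * ‖z‖ ^ 2 := by positivity
      linarith
    have hgi := integrable_exp_neg_mul_norm_sq (E := E) hr'
    obtain ⟨hm1, hm2⟩ := integral_norm_add_rpow_mul_gaussian hb hbn hr' x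
    rw [← hn] at hm1 hm2
    have hmix := gaussian_mixture_sub_eq (D := n / 2) (q := b / 2) (a := ‖x‖ ^ 2) (by positivity)
      hr' (by positivity) hm1
    have hux : ∫ t in Ioi (0 : ℝ), t ^ (b / 2 - 1) * exp (-(‖x‖ ^ 2 * t)) =
        Real.Gamma (b / 2) * ‖x‖ ^ (-b) := by
      simp_rw [mul_comm (‖x‖ ^ 2)]
      exact integral_rpow_mul_exp_neg_mul_norm_sq hb hx
    have hgauss : ∫ z : E, exp (-(r * ‖z‖ ^ 2)) = (π / r) ^ (n / 2) := by
      have h := GaussianFourier.integral_rexp_neg_mul_sq_norm (V := E) hr'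
      simpa only [neg_mul, ← hn] using h
    have hsub : ∫ z : E, (‖x + z‖ ^ (-b) - ‖x‖ ^ (-b)) * exp (-(r * ‖z‖ ^ 2)) =
        (∫ z : E, ‖x + z‖ ^ (-b) * exp (-(r * ‖z‖ ^ 2))) - ‖x‖ ^ (-b) * (π / r) ^ (n / 2) := by
      simp_rw [sub_mul]
      rw [integral_sub (integrable_norm_add_rpow_mul hb hbn hgi (by fun_prop) hgle x)
        (hgi.const_mul _), integral_const_mul, hgauss]
    have hpull : ∀ z, f z r = r ^ ((n + 2 * s) / 2 - 1) *
        (secondDiffNormRpow b x z * exp (-(r * ‖z‖ ^ 2))) := fun z => by simp only [hf]; ring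
    simp_rw [hpull]
    rw [integral_const_mul, (integral_secondDiffNormRpow_mul hb hbn hgi (by fun_prop) hgle
      (fun z => by rw [norm_neg]) x).2, hsub]
    rw [← hm2, hux, div_rpow pi_pos.le hr'.le] at hmix
    rw [div_rpow pi_pos.le hr'.le, show (n + 2 * s) / 2 - 1 = s - 1 + n / 2 by ring,
      rpow_add hr']
    have hrn : r ^ (n / 2) ≠ 0 := by positivity
    field_simp at hmix ⊢
    linear_combination hmix
  have hswap := integral_integral_swap hfi
  simp_rw [hfz] at hswap
  rw [integral_const_mul, setIntegral_congr_fun measurableSet_Ioi hft, integral_const_mul,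
    integral_integral_truncPowSub hs hs1 (by linarith) (by positivity) (by positivity)] at hswap
  have hpow : (1 / ‖x‖ ^ 2) ^ (b / 2 + s) = ‖x‖ ^ (-b - 2 * s) := by
    rw [one_div, ← rpow_natCast, ← rpow_neg hx0.le, ← rpow_mul hx0.le]
    congr 1
    push_cast
    ring
  rw [hpow, show b / 2 + s = (b + 2 * s) / 2 by ring, show n / 2 - b / 2 = (n - b) / 2 by ring,
    show (n - b) / 2 - s = (n - b - 2 * s) / 2 by ring] at hswap
  have hG3 := Real.Gamma_pos_of_pos (show 0 < (n - b - 2 * s) / 2 by linarith)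
  field_simp at hswap ⊢
  linear_combination hswap

end NormPower

/-- Fractional Laplacian of the power function `|x|^{-b}`: for `0 < b < d - 2s` and
`x ≠ 0`,
`P.V. ∫_{ℝ^d} (|y|^{-b} - |x|^{-b})/|x-y|^{d+2s} dy
  = -(π^{d/2} Γ((b+2s)/2) Γ((d-b)/2) |Γ(-s)|)/(Γ((d+2s)/2) Γ((d-b-2s)/2) Γ(b/2)) |x|^{-b-2s}`,
i.e. `A_{d,-2s}^{-1} Δ^s (|·|^{-b})(x)` equals the stated right-hand side. -/
theorem stmt_19 (d : ℕ) (s b : ℝ) (hd : 1 ≤ d) (hs : 0 < s) (hs1 : s < 1)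
    (hsd : 2 * s < d) (hb : b ∈ Ioo (0 : ℝ) ((d : ℝ) - 2 * s))
    (x : EuclideanSpace ℝ (Fin d)) (hx : x ≠ 0) :
    Tendsto
      (fun ε : ℝ =>
        ∫ y in {y : EuclideanSpace ℝ (Fin d) | ε < dist x y},
          (‖y‖ ^ (-b) - ‖x‖ ^ (-b)) / ‖x - y‖ ^ ((d : ℝ) + 2 * s))
      (𝓝[>] 0)
      (𝓝 (-(π ^ ((d : ℝ) / 2) * Real.Gamma ((b + 2 * s) / 2) *
              Real.Gamma (((d : ℝ) - b) / 2) * |Real.Gamma (-s)|) /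
            (Real.Gamma (((d : ℝ) + 2 * s) / 2) *
              Real.Gamma (((d : ℝ) - b - 2 * s) / 2) * Real.Gamma (b / 2)) *
          ‖x‖ ^ (-b - 2 * s))) := by
  obtain ⟨hb0, hb1⟩ := hb
  have : Nontrivial (EuclideanSpace ℝ (Fin d)) := ⟨x, 0, hx⟩
  have hfr : (Module.finrank ℝ (EuclideanSpace ℝ (Fin d)) : ℝ) = d := by simp
  have hlim := tendsto_truncated_integral (b := b) (p := -((d : ℝ) + 2 * s)) hb0
    (by rw [hfr]; linarith) (by rw [hfr]; linarith) (by rw [hfr]; linarith) hx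
  have hval := integral_secondDiffNormRpow_mul_rpow hb0 hs hs1 (by rwa [hfr]) hx
  rw [hfr] at hval
  have hneg : |Real.Gamma (-s)| = -Real.Gamma (-s) := by
    have h := Real.Gamma_add_one (s := -s) (by linarith)
    have h' := Real.Gamma_pos_of_pos (show 0 < -s + 1 by linarith)
    exact abs_of_neg (by nlinarith)
  rw [hval] at hlim
  rw [hneg, mul_neg, neg_neg]
  simpa only [div_eq_mul_inv, rpow_neg (norm_nonneg _)] using hlim
end
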